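/- arXiv:1507.05548 — 2 statements merged into one kernel-verified Lean document; each statement's English description precedes it below -/
import Mathlib

section
/- Let A, B, C be finite subsets of 𝔽_p with |A| = |B| = |C| ≤ √p, and let d ∈ 𝔽_p be a fixed nonzero element. Then max(|A·B|, |(A+d)·C|) ≫ |A|^{1 + 1/26}, where A·B = {ab : a ∈ A, b ∈ B} and A+d = {a + d : a ∈ A}. -/
open Pointwise

lemma asp_cs_pairs {ι U : Type*} [DecidableEq ι] (I : Finset ι) (V : Finset U) (f : ι → U → ℝ)
    (T : ℝ) (hT : 0 < T) (hle : T ≤ ∑ i ∈ I, ∑ u ∈ V, f i u)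
    (hd : 2 * (V.card : ℝ) * ∑ i ∈ I, ∑ u ∈ V, (f i u) ^ 2 ≤ (∑ i ∈ I, ∑ u ∈ V, f i u) ^ 2) :
    ∃ i ∈ I, ∃ j ∈ I, i ≠ j ∧ T ^ 2 ≤ 2 * (V.card : ℝ) * (I.card : ℝ) ^ 2 * ∑ u ∈ V, f i u * f j u := by
  by_contra! hcon
  set W := ∑ i ∈ I, ∑ u ∈ V, f i u with hW
  have h1 : W ^ 2 ≤ (V.card : ℝ) * ∑ u ∈ V, (∑ i ∈ I, f i u) ^ 2 := by
    rw [hW, Finset.sum_comm]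
    exact sq_sum_le_card_mul_sum_sq
  have h2 : ∑ u ∈ V, (∑ i ∈ I, f i u) ^ 2 = ∑ q ∈ I ×ˢ I, ∑ u ∈ V, f q.1 u * f q.2 u := by
    rw [Finset.sum_comm]
    refine Finset.sum_congr rfl fun u _ => ?_
    rw [sq, Finset.sum_mul_sum, Finset.sum_product]
  have h3 : ∑ q ∈ I ×ˢ I, ∑ u ∈ V, f q.1 u * f q.2 u
      = (∑ i ∈ I, ∑ u ∈ V, (f i u) ^ 2) + ∑ q ∈ I.offDiag, ∑ u ∈ V, f q.1 u * f q.2 u := by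
    rw [← Finset.diag_union_offDiag, Finset.sum_union (Finset.disjoint_diag_offDiag _), Finset.sum_diag]
    simp only [sq]
  set off := ∑ q ∈ I.offDiag, ∑ u ∈ V, f q.1 u * f q.2 u with hoff
  have h4 : W ^ 2 ≤ 2 * (V.card : ℝ) * off := by
    rw [h2, h3] at h1; nlinarith
  have hW0 : 0 < W := lt_of_lt_of_le hT hle
  have hne : I.offDiag.Nonempty := by
    by_contra hne
    rw [Finset.not_nonempty_iff_eq_empty] at hne
    rw [hoff, hne] at h4
    simp at h4
    exact absurd h4 hW0.ne'
  have h5 : 2 * (V.card : ℝ) * (I.card : ℝ) ^ 2 * off < (I.card : ℝ) ^ 2 * T ^ 2 := by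
    rw [hoff, Finset.mul_sum]
    calc _ < ∑ q ∈ I.offDiag, T ^ 2 := by
          refine Finset.sum_lt_sum_of_nonempty hne fun q hq => ?_
          rw [Finset.mem_offDiag] at hq
          exact hcon _ hq.1 _ hq.2.1 hq.2.2
      _ = (I.offDiag.card : ℝ) * T ^ 2 := by simp
      _ ≤ _ := by
          gcongr
          rw [Finset.offDiag_card, sq]
          exact_mod_cast Nat.sub_le _ _
  have h6 : T ^ 2 ≤ W ^ 2 := by gcongr
  have h7 : (0:ℝ) ≤ (I.card : ℝ) ^ 2 := by positivity
  nlinarith [mul_le_mul_of_nonneg_left (h6.trans h4) h7]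

/-- set version -/
lemma asp_cs_sets {ι U : Type*} [DecidableEq ι] [DecidableEq U] (I : Finset ι) (V : Finset U)
    (Ω : ι → Finset U) (hΩ : ∀ i ∈ I, Ω i ⊆ V) (Z : ℝ) (hZ : 0 < Z) (hI : I.Nonempty)
    (hZΩ : ∀ i ∈ I, Z ≤ ((Ω i).card : ℝ)) (hd : 2 * (V.card : ℝ) ≤ (I.card : ℝ) * Z) :
    ∃ i ∈ I, ∃ j ∈ I, i ≠ j ∧ Z ^ 2 ≤ 2 * (V.card : ℝ) * ((Ω i ∩ Ω j).card : ℝ) := by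
  have hs : ∀ i ∈ I, ∑ u ∈ V, (if u ∈ Ω i then (1:ℝ) else 0) = ((Ω i).card : ℝ) := by
    intro i hi
    rw [Finset.sum_ite_mem, Finset.inter_eq_right.2 (hΩ i hi)]; simp
  have hIpos : (0:ℝ) < I.card := by exact_mod_cast hI.card_pos
  have htot : (I.card : ℝ) * Z ≤ ∑ i ∈ I, ∑ u ∈ V, (if u ∈ Ω i then (1:ℝ) else 0) := by
    rw [Finset.sum_congr rfl hs, ← nsmul_eq_mul]
    exact Finset.card_nsmul_le_sum _ _ _ hZΩ
  obtain ⟨i, hi, j, hj, hij, h⟩ := asp_cs_pairs I V (fun i u => if u ∈ Ω i then (1:ℝ) else 0)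
    ((I.card : ℝ) * Z) (by positivity) htot (by
      have : ∀ i u, (if u ∈ Ω i then (1:ℝ) else 0) ^ 2 = if u ∈ Ω i then (1:ℝ) else 0 := by
        intro i u; split_ifs <;> simp
      simp only [this]
      have h0 : 0 ≤ (I.card : ℝ) * Z := by positivity
      nlinarith)
  refine ⟨i, hi, j, hj, hij, ?_⟩
  have h8 : ∑ u ∈ V, (if u ∈ Ω i then (1:ℝ) else 0) * (if u ∈ Ω j then (1:ℝ) else 0)
      = ((Ω i ∩ Ω j).card : ℝ) := by
    have : ∀ u, (if u ∈ Ω i then (1:ℝ) else 0) * (if u ∈ Ω j then (1:ℝ) else 0)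
      = if u ∈ Ω i ∩ Ω j then 1 else 0 := by
      intro u; simp only [Finset.mem_inter]; split_ifs <;> simp_all
    simp only [this]
    rw [Finset.sum_ite_mem, Finset.inter_eq_right.2]
    · simp
    · exact Finset.inter_subset_left.trans (hΩ i hi)
  simp only [h8] at h
  have h9 : (0:ℝ) < (I.card : ℝ) ^ 2 := by positivity
  have : (I.card : ℝ) ^ 2 * Z ^ 2 ≤ (I.card : ℝ) ^ 2 * (2 * (V.card : ℝ) * ((Ω i ∩ Ω j).card : ℝ)) := by
    nlinarith
  exact le_of_mul_le_mul_left this h9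

lemma asp_prune {F : Type*} [DecidableEq F] (B : Finset F) (f : F → F → ℝ)
    (T : ℝ) (hT : 0 < T) (hTf : T ≤ ∑ b ∈ B, ∑ b' ∈ B, f b b') (δ : ℝ)
    (hδ : 0 ≤ δ) (hδT : 4 * (B.card : ℝ) * δ ≤ T) :
    ∃ B1 ⊆ B, ∃ B2 ⊆ B, B1.Nonempty ∧ B2.Nonempty ∧
      (∀ b ∈ B1, δ ≤ ∑ b' ∈ B2, f b b') ∧ (∀ b' ∈ B2, δ ≤ ∑ b ∈ B1, f b b') := by
  obtain ⟨⟨B1, B2⟩, hm, hmax⟩ := Finset.exists_max_image (B.powerset ×ˢ B.powerset)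
    (fun q => (∑ b ∈ q.1, ∑ b' ∈ q.2, f b b') - δ * ((q.1.card : ℝ) + q.2.card))
    ⟨(B, B), by simp⟩
  simp only [Finset.mem_product, Finset.mem_powerset] at hm hmax
  have h0 := hmax (B, B) (by simp)
  simp only at h0
  have hpos : 0 < (∑ b ∈ B1, ∑ b' ∈ B2, f b b') - δ * ((B1.card : ℝ) + B2.card) := by
    refine lt_of_lt_of_le ?_ h0
    nlinarith
  refine ⟨B1, hm.1, B2, hm.2, ?_, ?_, ?_, ?_⟩
  · by_contra h
    rw [Finset.not_nonempty_iff_eq_empty] at h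
    subst h
    simp at hpos
    have : 0 ≤ δ * (B2.card : ℝ) := by positivity
    linarith
  · by_contra h
    rw [Finset.not_nonempty_iff_eq_empty] at h
    subst h
    simp at hpos
    have : 0 ≤ δ * (B1.card : ℝ) := by positivity
    linarith
  · intro b hb
    have h := hmax (B1.erase b, B2) ⟨(Finset.erase_subset _ _).trans hm.1, hm.2⟩
    simp only at h
    rw [← Finset.sum_erase_add _ _ hb] at h
    have hc : (B1.card : ℝ) = (B1.erase b).card + 1 := by
      exact_mod_cast (Finset.card_erase_add_one hb).symm
    rw [hc] at h
    nlinarith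
  · intro b hb
    have h := hmax (B1, B2.erase b) ⟨hm.1, (Finset.erase_subset _ _).trans hm.2⟩
    simp only at h
    have h' : ∑ x ∈ B1, ∑ b' ∈ B2, f x b' = ∑ x ∈ B1, ∑ b' ∈ B2.erase b, f x b' + ∑ x ∈ B1, f x b := by
      rw [← Finset.sum_add_distrib]
      refine Finset.sum_congr rfl fun x _ => ?_
      rw [Finset.sum_erase_add _ _ hb]
    rw [h'] at h
    have hc : (B2.card : ℝ) = (B2.erase b).card + 1 := by
      exact_mod_cast (Finset.card_erase_add_one hb).symm
    rw [hc] at h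
    nlinarith

section
variable {F : Type*} [Field F] [DecidableEq F]

/-- number of `w = (b,c)` in `B × C` whose map sends `ξ` to `ω` -/
def aspFib (B C : Finset F) (d ξ ω : F) : Finset (F × F) :=
  (B ×ˢ C).filter fun w => w.2 * (ξ / w.1 + d) = ω

lemma asp_step (A B1 B2 C Y : Finset F) (d : F) (hd : d ≠ 0)
    (hY : ∀ a ∈ A, ∀ c ∈ C, (a + d) * c ∈ Y) (hC0 : ∀ c ∈ C, c ≠ 0)
    (hB1 : ∀ b ∈ B1, b ≠ 0) (hB2 : ∀ b ∈ B2, b ≠ 0) (u v : F) (hu : u ≠ 0)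
    (Z : ℝ) (hZ : 0 < Z)
    (hdeg : ∀ b ∈ B1, Z ≤ (((A ×ˢ B2).filter fun q => (u * (q.1 * b) + v) / q.2 ∈ A).card : ℝ))
    (ξ s : F) (hΦne : (aspFib B1 C d ξ s).Nonempty)
    (hΦ : 2 * ((Y.card : ℝ) * B2.card) ≤ ((aspFib B1 C d ξ s).card : ℝ) * Z) :
    ∃ ρ : F, ρ ≠ 0 ∧ ρ ≠ 1 ∧ (C.card : ℝ) * Z ^ 2 ≤ 2 * ((Y.card : ℝ) * B2.card) *
      ∑ q ∈ Y ×ˢ Y, ((aspFib B2 C d (u * ξ + v) ((q.1 - ρ * q.2) / (1 - ρ))).card : ℝ) := by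
  set Ω : F × F → Finset (F × F) := fun w => (Y ×ˢ B2).filter fun q =>
    q.1 / w.2 - d ∈ A ∧ (u * ((q.1 / w.2 - d) * w.1) + v) / q.2 ∈ A with hΩ
  have hcardV : ((Y ×ˢ B2).card : ℝ) = (Y.card : ℝ) * B2.card := by
    rw [Finset.card_product]; push_cast; rfl
  obtain ⟨w1, hw1, w2, hw2, hne, hcs⟩ := asp_cs_sets (aspFib B1 C d ξ s) (Y ×ˢ B2) Ω
    (fun i _ => Finset.filter_subset _ _) Z hZ hΦne (by
      intro w hw
      simp only [aspFib, Finset.mem_filter, Finset.mem_product] at hw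
      obtain ⟨⟨hwb, hwc⟩, -⟩ := hw
      have hc0 := hC0 _ hwc
      refine (hdeg _ hwb).trans ?_
      norm_cast
      refine Finset.card_le_card_of_injOn (fun q => ((q.1 + d) * w.2, q.2)) ?_ ?_
      · rintro ⟨a, b'⟩ hq
        simp only [Finset.coe_filter, Finset.mem_product, Set.mem_ofPred_eq] at hq
        simp only [hΩ, Finset.coe_filter, Finset.mem_product, Set.mem_ofPred_eq]
        rw [mul_div_cancel_right₀ _ hc0, add_sub_cancel_right]
        exact ⟨⟨hY _ hq.1.1 _ hwc, hq.1.2⟩, hq.1.1, hq.2⟩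
      · rintro ⟨a, b'⟩ - ⟨a2, b2'⟩ - h
        simp only [Prod.mk.injEq] at h
        obtain ⟨h1, h2⟩ := h
        have := mul_right_cancel₀ hc0 h1
        simp_all) (by rw [hcardV]; exact hΦ)
  obtain ⟨b1, c1⟩ := w1
  obtain ⟨b2, c2⟩ := w2
  simp only [aspFib, Finset.mem_filter, Finset.mem_product] at hw1 hw2
  obtain ⟨⟨hb1, hc1⟩, hs1⟩ := hw1
  obtain ⟨⟨hb2, hc2⟩, hs2⟩ := hw2
  have hb10 := hB1 _ hb1
  have hb20 := hB1 _ hb2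
  have hc10 := hC0 _ hc1
  have hc20 := hC0 _ hc2
  set ρ := (b1 * c2) / (c1 * b2) with hρ
  have hρ1 : ρ ≠ 1 := by
    intro h
    rw [hρ, div_eq_one_iff_eq (by positivity)] at h
    have e1 : c1 * d = c2 * d := by
      have e2 : c1 * (ξ / b1 + d) = c2 * (ξ / b2 + d) := hs1.trans hs2.symm
      have e3 : c1 * (ξ / b1) = c2 * (ξ / b2) := by
        field_simp
        linear_combination (-ξ) * h
      linear_combination e2 - e3
    have e4 := mul_right_cancel₀ hd e1
    subst e4
    rw [mul_comm] at h
    have e5 := mul_left_cancel₀ hc10 h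
    exact hne (by rw [e5])
  have hρ' : (1:F) - ρ ≠ 0 := sub_ne_zero.2 hρ1.symm
  refine ⟨ρ, by positivity, hρ1, ?_⟩
  rw [hcardV] at hcs
  have key : (C.card : ℝ) * ((Ω (b1, c1) ∩ Ω (b2, c2)).card : ℝ) ≤
      ∑ q ∈ Y ×ˢ Y, ((aspFib B2 C d (u * ξ + v) ((q.1 - ρ * q.2) / (1 - ρ))).card : ℝ) := by
    norm_cast
    rw [← Finset.card_sigma, mul_comm, ← Finset.card_product]
    refine Finset.card_le_card_of_injOn (fun q =>
      ⟨(q.2 * ((u * ((q.1.1 / c1 - d) * b1) + v) / q.1.2 + d),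
        q.2 * ((u * ((q.1.1 / c2 - d) * b2) + v) / q.1.2 + d)), (q.1.2, q.2)⟩) ?_ ?_
    · rintro ⟨⟨y, b'⟩, c'⟩ hq
      simp only [hΩ, Finset.coe_product, Set.mem_prod, Finset.mem_coe, Finset.mem_inter,
        Finset.mem_filter, Finset.mem_product] at hq
      obtain ⟨⟨⟨⟨hy, hb'⟩, hA1, hA1'⟩, ⟨-, hA2, hA2'⟩⟩, hc'⟩ := hq
      have hb'0 := hB2 _ hb'
      simp only [Finset.coe_sigma, Set.mem_sigma_iff, Finset.mem_coe, Finset.mem_product, aspFib,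
        Finset.mem_filter]
      refine ⟨⟨?_, ?_⟩, ⟨hb', hc'⟩, ?_⟩
      · rw [mul_comm]; exact hY _ hA1' _ hc'
      · rw [mul_comm]; exact hY _ hA2' _ hc'
      · rw [eq_div_iff hρ']
        have f1 : (y / c1 - d) * b1 - ξ = (y - s) * (b1 / c1) := by
          rw [← hs1]; field_simp; ring
        have f2 : (y / c2 - d) * b2 - ξ = (y - s) * (b2 / c2) := by
          rw [← hs2]; field_simp; ring
        have f3 : (y / c1 - d) * b1 - ξ = ρ * ((y / c2 - d) * b2 - ξ) := by
          rw [f1, f2, hρ]; field_simp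
        generalize (y / c1 - d) * b1 = x1 at *
        generalize (y / c2 - d) * b2 = x2 at *
        generalize ρ = r at *
        have f4 : x1 = ξ + r * (x2 - ξ) := by linear_combination f3
        rw [f4]
        field_simp
        ring
    · rintro ⟨⟨y, b'⟩, c'⟩ hq ⟨⟨y2, b2'⟩, c2'⟩ - h
      simp only [hΩ, Finset.coe_product, Set.mem_prod, Finset.mem_coe, Finset.mem_inter,
        Finset.mem_filter, Finset.mem_product] at hq
      obtain ⟨⟨⟨⟨hy, hb'⟩, hA1, hA1'⟩, ⟨-, hA2, hA2'⟩⟩, hc'⟩ := hq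
      have hb'0 := hB2 _ hb'
      have hc'0 := hC0 _ hc'
      simp only [Sigma.mk.injEq, Prod.mk.injEq, heq_eq_eq] at h
      obtain ⟨⟨h1, -⟩, rfl, rfl⟩ := h
      have g1 := add_right_cancel (mul_left_cancel₀ hc'0 h1)
      rw [div_left_inj' hb'0] at g1
      have g2 := mul_right_cancel₀ hb10 (mul_left_cancel₀ hu (add_right_cancel g1))
      have g3 := sub_left_injective g2
      rw [div_left_inj' hc10] at g3
      rw [g3]
  calc (C.card : ℝ) * Z ^ 2 ≤ (C.card : ℝ) * (2 * ((Y.card : ℝ) * B2.card) *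
        ((Ω (b1, c1) ∩ Ω (b2, c2)).card : ℝ)) := by gcongr
    _ = 2 * ((Y.card : ℝ) * B2.card) * ((C.card : ℝ) * ((Ω (b1, c1) ∩ Ω (b2, c2)).card : ℝ)) := by ring
    _ ≤ _ := by gcongr

end

section
variable {F : Type*} [Field F] [DecidableEq F]

lemma asp_cor_a (B2 C Y : Finset F) (d x ρ : F) (hYne : Y.Nonempty) :
    ∃ ω, ∑ q ∈ Y ×ˢ Y, ((aspFib B2 C d x ((q.1 - ρ * q.2) / (1 - ρ))).card : ℝ)
      ≤ (Y.card : ℝ) ^ 2 * ((aspFib B2 C d x ω).card : ℝ) := by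
  obtain ⟨q0, hq0, hmax⟩ := Finset.exists_max_image (Y ×ˢ Y)
    (fun q => ((aspFib B2 C d x ((q.1 - ρ * q.2) / (1 - ρ))).card : ℝ)) (hYne.product hYne)
  refine ⟨(q0.1 - ρ * q0.2) / (1 - ρ), ?_⟩
  refine (Finset.sum_le_card_nsmul _ _ _ hmax).trans ?_
  rw [nsmul_eq_mul, Finset.card_product]
  push_cast
  rw [sq]

lemma asp_cor_b [Fintype F] (B2 C Y : Finset F) (d x ρ : F) (h0 : ρ ≠ 0) (h1 : ρ ≠ 1) :
    (∑ q ∈ Y ×ˢ Y, ((aspFib B2 C d x ((q.1 - ρ * q.2) / (1 - ρ))).card : ℝ)) ^ 2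
      ≤ (Y.card : ℝ) ^ 3 * ∑ ω : F, ((aspFib B2 C d x ω).card : ℝ) ^ 2 := by
  have h1' : (1:F) - ρ ≠ 0 := sub_ne_zero.2 h1.symm
  refine (sq_sum_le_card_mul_sum_sq).trans ?_
  rw [Finset.card_product, Finset.sum_product]
  have : ∀ p1 ∈ Y, ∑ p2 ∈ Y, ((aspFib B2 C d x ((p1 - ρ * p2) / (1 - ρ))).card : ℝ) ^ 2
      ≤ ∑ ω : F, ((aspFib B2 C d x ω).card : ℝ) ^ 2 := by
    intro p1 _
    have hinj : Set.InjOn (fun p2 => (p1 - ρ * p2) / (1 - ρ)) (Y : Set F) := by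
      intro a _ b _ h
      simp only [div_left_inj' h1'] at h
      exact mul_left_cancel₀ h0 (sub_right_injective h)
    rw [← Finset.sum_image (f := fun ω => ((aspFib B2 C d x ω).card : ℝ) ^ 2) hinj]
    exact Finset.sum_le_sum_of_subset_of_nonneg (Finset.subset_univ _) (fun _ _ _ => by positivity)
  have h2 := Finset.sum_le_card_nsmul _ _ _ this
  rw [nsmul_eq_mul] at h2
  push_cast
  calc _ ≤ (Y.card : ℝ) * Y.card * ((Y.card : ℝ) * ∑ ω : F, ((aspFib B2 C d x ω).card : ℝ) ^ 2) := by
        gcongr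
    _ = _ := by ring

lemma asp_energy [Fintype F] (B C : Finset F) (d x : F) :
    ∑ ω : F, ((aspFib B C d x ω).card : ℝ) ^ 2 =
      ∑ w ∈ B ×ˢ C, ∑ w' ∈ B ×ˢ C,
        if w.2 * (x / w.1 + d) = w'.2 * (x / w'.1 + d) then (1:ℝ) else 0 := by
  have : ∀ ω, ((aspFib B C d x ω).card : ℝ) ^ 2 = ∑ w ∈ B ×ˢ C, ∑ w' ∈ B ×ˢ C,
      (if w.2 * (x / w.1 + d) = ω then (1:ℝ) else 0) * (if w'.2 * (x / w'.1 + d) = ω then (1:ℝ) else 0) := by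
    intro ω
    rw [← Finset.sum_mul_sum, ← sq]
    simp [aspFib]
  simp only [this]
  rw [Finset.sum_comm]
  refine Finset.sum_congr rfl fun w _ => ?_
  rw [Finset.sum_comm]
  refine Finset.sum_congr rfl fun w' _ => ?_
  simp [eq_comm]

lemma asp_avg [Fintype F] (B C : Finset F) (d : F) (hd : d ≠ 0) (hB : ∀ b ∈ B, b ≠ 0)
    (hC : ∀ c ∈ C, c ≠ 0) (hcard : B.card * C.card ≤ Fintype.card F) :
    ∃ x : F, ∑ ω : F, ((aspFib B C d x ω).card : ℝ) ^ 2 ≤ 2 * ((B.card : ℝ) * C.card) := by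
  by_contra! hcon
  simp only [asp_energy] at hcon
  have h1 : ∑ x : F, (2 * ((B.card : ℝ) * C.card)) < ∑ x : F, ∑ w ∈ B ×ˢ C, ∑ w' ∈ B ×ˢ C,
        if w.2 * (x / w.1 + d) = w'.2 * (x / w'.1 + d) then (1:ℝ) else 0 :=
    Finset.sum_lt_sum_of_nonempty ⟨0, Finset.mem_univ _⟩ fun x _ => hcon x
  rw [Finset.sum_comm] at h1
  have h2 : ∀ w ∈ B ×ˢ C, ∑ x : F, ∑ w' ∈ B ×ˢ C,
      (if w.2 * (x / w.1 + d) = w'.2 * (x / w'.1 + d) then (1:ℝ) else 0) ≤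
        Fintype.card F + (B.card : ℝ) * C.card := by
    rintro ⟨b, c⟩ hw
    rw [Finset.mem_product] at hw
    rw [Finset.sum_comm]
    have h3 : ∀ w' ∈ B ×ˢ C, ∑ x : F,
      (if c * (x / b + d) = w'.2 * (x / w'.1 + d) then (1:ℝ) else 0) ≤
        (if w' = (b, c) then (Fintype.card F : ℝ) else 0) + 1 := by
      rintro ⟨b', c'⟩ hw'
      rw [Finset.mem_product] at hw'
      have hb := hB _ hw.1
      have hc := hC _ hw.2
      have hb' := hB _ hw'.1
      have hc' := hC _ hw'.2
      simp only at hb hc hb' hc'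
      split_ifs with heq
      · refine le_trans (Finset.sum_le_card_nsmul _ _ 1 ?_) ?_
        · intro x _; split_ifs <;> norm_num
        · simp [Finset.card_univ]
      · rw [Finset.sum_boole, zero_add]
        norm_cast
        rw [Finset.card_le_one]
        intro x hx y hy
        simp only [Finset.mem_filter, Finset.mem_univ, true_and] at hx hy
        have e1 : (x - y) * (c / b - c' / b') = 0 := by
          linear_combination hx - hy
        rcases mul_eq_zero.1 e1 with e | e
        · exact sub_eq_zero.1 e
        · exfalso
          have e2 : c * d = c' * d := by linear_combination hx - x * e
          have e3 := mul_right_cancel₀ hd e2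
          subst e3
          apply heq
          have e4 := sub_eq_zero.1 e
          rw [div_eq_div_iff hb hb'] at e4
          rw [mul_left_cancel₀ hc e4]
    refine (Finset.sum_le_sum h3).trans ?_
    rw [Finset.sum_add_distrib, Finset.sum_ite_eq' ]
    simp [hw.1, hw.2]
  have h4 := h1.trans_le (Finset.sum_le_card_nsmul _ _ _ h2)
  rw [nsmul_eq_mul, Finset.card_product, Finset.sum_const, nsmul_eq_mul, Finset.card_univ] at h4
  have h5 : (B.card : ℝ) * C.card ≤ Fintype.card F := by exact_mod_cast hcard
  push_cast at h4
  have h6 : 0 ≤ (B.card : ℝ) * C.card := by positivity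
  nlinarith

/-- popularity -/
lemma asp_pop (A B X : Finset F) (hB : ∀ b ∈ B, b ≠ 0) (hX : ∀ a ∈ A, ∀ b ∈ B, a * b ∈ X)
    (t : ℝ) (ht : 0 ≤ t) (htX : 16 * (t * X.card) ≤ A.card * B.card) (hBne : B.Nonempty) :
    ∃ A0 ⊆ A, 3 * (A.card : ℝ) ≤ 4 * A0.card ∧ ∀ a ∈ A0, ∀ a' ∈ A0,
      (B.card : ℝ) * t ^ 2 ≤ 2 * ∑ β ∈ B, ((B.filter fun b => a * β / b ∈ A).card : ℝ) *
        ((B.filter fun b => a' * β / b ∈ A).card : ℝ) := by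
  set r : F → ℝ := fun x => ((B.filter fun b => x / b ∈ A).card : ℝ) with hr
  have hr0 : ∀ x, 0 ≤ r x := fun x => by positivity
  set bad : F → Finset F := fun a => B.filter fun β => r (a * β) < t with hbad
  have hBpos : (0:ℝ) < B.card := by exact_mod_cast hBne.card_pos
  have hcount : ∑ a ∈ A, ((bad a).card : ℝ) ≤ t * X.card := by
    set P := (A ×ˢ B).filter fun q => r (q.1 * q.2) < t with hP
    have e1 : ∑ a ∈ A, ((bad a).card : ℝ) = P.card := by
      rw [hP, Finset.card_filter, Finset.sum_product]
      push_cast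
      refine Finset.sum_congr rfl fun a _ => ?_
      rw [hbad]; simp only [Finset.card_filter]; push_cast; rfl
    have e2 : P.card = ∑ x ∈ X, (P.filter fun q => q.1 * q.2 = x).card := by
      refine Finset.card_eq_sum_card_fiberwise ?_
      intro q hq
      simp only [hP, Finset.coe_filter, Finset.mem_product, Set.mem_ofPred_eq] at hq
      exact hX _ hq.1.1 _ hq.1.2
    rw [e1, e2]
    push_cast
    rw [mul_comm, ← nsmul_eq_mul]
    refine Finset.sum_le_card_nsmul _ _ _ fun x _ => ?_
    by_cases hx : r x < t
    · refine le_trans ?_ hx.le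
      simp only [hr]
      norm_cast
      refine Finset.card_le_card_of_injOn (fun q => q.2) ?_ ?_
      · rintro ⟨a, b⟩ hq
        simp only [hP, Finset.coe_filter, Finset.mem_filter, Finset.mem_product, Set.mem_ofPred_eq] at hq
        simp only [Finset.coe_filter, Set.mem_ofPred_eq]
        refine ⟨hq.1.1.2, ?_⟩
        rw [← hq.2, mul_div_cancel_right₀ _ (hB _ hq.1.1.2)]
        exact hq.1.1.1
      · rintro ⟨a, b⟩ hq ⟨a', b'⟩ hq' h
        simp only [hP, Finset.coe_filter, Finset.mem_filter, Finset.mem_product, Set.mem_ofPred_eq] at hq hq'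
        simp only at h
        subst h
        have := mul_right_cancel₀ (hB _ hq.1.1.2) (hq.2.trans hq'.2.symm)
        rw [this]
    · rw [Finset.filter_eq_empty_iff.2]
      · simpa using ht
      · intro q hq h
        rw [hP, Finset.mem_filter] at hq
        rw [h] at hq
        exact hx hq.2
  set A0 := A.filter fun a => 4 * ((bad a).card : ℝ) ≤ B.card with hA0
  refine ⟨A0, Finset.filter_subset _ _, ?_, ?_⟩
  · have e1 : (A.card : ℝ) = A0.card + (A.filter fun a => ¬ (4 * ((bad a).card : ℝ) ≤ B.card)).card := by
      rw [hA0]; exact_mod_cast (Finset.card_filter_add_card_filter_not _).symm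
    set A1 := A.filter fun a => ¬ (4 * ((bad a).card : ℝ) ≤ B.card) with hA1
    have e2 : (A1.card : ℝ) * (B.card / 4) ≤ ∑ a ∈ A1, ((bad a).card : ℝ) := by
      rw [← nsmul_eq_mul]
      refine Finset.card_nsmul_le_sum _ _ _ fun a ha => ?_
      rw [hA1, Finset.mem_filter] at ha
      linarith [ha.2]
    have e3 : ∑ a ∈ A1, ((bad a).card : ℝ) ≤ ∑ a ∈ A, ((bad a).card : ℝ) :=
      Finset.sum_le_sum_of_subset_of_nonneg (Finset.filter_subset _ _) fun _ _ _ => by positivity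
    have e4 : (A1.card : ℝ) * 4 ≤ A.card := by
      by_contra! h
      nlinarith
    linarith
  · intro a ha a' ha'
    rw [hA0, Finset.mem_filter] at ha ha'
    set G := B \ (bad a ∪ bad a') with hG
    have e1 : (B.card : ℝ) ≤ 2 * G.card := by
      have : B.card ≤ G.card + (bad a ∪ bad a').card := by
        have := Finset.le_card_sdiff (bad a ∪ bad a') B
        rw [← hG] at this
        omega
      have h3 := Finset.card_union_le (bad a) (bad a')
      have h4 : (B.card : ℝ) ≤ G.card + ((bad a).card + (bad a').card) := by exact_mod_cast this.trans (by omega)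
      linarith [ha.2, ha'.2]
    have e2 : (G.card : ℝ) * t ^ 2 ≤ ∑ β ∈ G, r (a * β) * r (a' * β) := by
      rw [← nsmul_eq_mul]
      refine Finset.card_nsmul_le_sum _ _ _ fun β hβ => ?_
      simp only [hG, hbad, Finset.mem_sdiff, Finset.mem_union, Finset.mem_filter] at hβ
      have g1 : t ≤ r (a * β) := by
        by_contra! h; exact hβ.2 (Or.inl ⟨hβ.1, h⟩)
      have g2 : t ≤ r (a' * β) := by
        by_contra! h; exact hβ.2 (Or.inr ⟨hβ.1, h⟩)
      nlinarith
    have e3 : ∑ β ∈ G, r (a * β) * r (a' * β) ≤ ∑ β ∈ B, r (a * β) * r (a' * β) :=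
      Finset.sum_le_sum_of_subset_of_nonneg Finset.sdiff_subset fun _ _ _ => mul_nonneg (hr0 _) (hr0 _)
    have : 0 ≤ t ^ 2 := by positivity
    nlinarith
end

section
variable {F : Type*} [Field F] [DecidableEq F]

/-- the weights -/
noncomputable def aspTh (A A1 : Finset F) (μ d β b b' : F) : ℝ :=
  ∑ a ∈ A1, (if a * β / b ∈ A then (1:ℝ) else 0) * (if (μ * (a + d) - d) * β / b' ∈ A then (1:ℝ) else 0)

lemma aspTh_eq (A A1 : Finset F) (μ d β b b' : F) : aspTh A A1 μ d β b b' =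
    ∑ a ∈ A1, if a * β / b ∈ A ∧ (μ * (a + d) - d) * β / b' ∈ A then (1:ℝ) else 0 := by
  unfold aspTh
  refine Finset.sum_congr rfl fun a _ => ?_
  split_ifs <;> simp_all

lemma aspTh_nonneg (A A1 : Finset F) (μ d β b b' : F) : 0 ≤ aspTh A A1 μ d β b b' := by
  rw [aspTh_eq]
  exact Finset.sum_nonneg fun a _ => by split_ifs <;> norm_num

lemma aspTh_le (A A1 : Finset F) (μ d β b b' : F) : aspTh A A1 μ d β b b' ≤ A1.card := by
  rw [aspTh_eq]
  refine (Finset.sum_le_card_nsmul _ _ 1 fun a _ => by split_ifs <;> norm_num).trans ?_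
  simp

lemma aspTh_deg1 (A A1 B2 : Finset F) (μ d β b : F) (hβ : β ≠ 0) (hb : b ≠ 0) :
    ∑ b' ∈ B2, aspTh A A1 μ d β b b' ≤
      (((A ×ˢ B2).filter fun q => (μ * (q.1 * b) + (μ - 1) * d * β) / q.2 ∈ A).card : ℝ) := by
  simp only [aspTh_eq]
  rw [← Finset.sum_product', Finset.sum_boole]
  norm_cast
  refine Finset.card_le_card_of_injOn (fun q => (q.2 * β / b, q.1)) ?_ ?_
  · rintro ⟨b', a⟩ hq
    simp only [Finset.coe_filter, Finset.mem_product, Set.mem_ofPred_eq] at hq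
    simp only [Finset.coe_filter, Finset.mem_product, Set.mem_ofPred_eq]
    refine ⟨⟨hq.2.1, hq.1.1⟩, ?_⟩
    rw [div_mul_cancel₀ _ hb]
    have : μ * (a * β) + (μ - 1) * d * β = (μ * (a + d) - d) * β := by ring
    rw [this]
    exact hq.2.2
  · rintro ⟨b', a⟩ - ⟨b'', a'⟩ - h
    simp only [Prod.mk.injEq, div_left_inj' hb] at h
    rw [h.2, mul_right_cancel₀ hβ h.1]

lemma aspTh_deg2 (A A1 B1 : Finset F) (μ d β b' : F) (hμ : μ ≠ 0) (hβ : β ≠ 0) (hb : b' ≠ 0) :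
    ∑ b ∈ B1, aspTh A A1 μ d β b b' ≤
      (((A ×ˢ B1).filter fun q => (μ⁻¹ * (q.1 * b') + (-(μ⁻¹ * ((μ - 1) * d * β)))) / q.2 ∈ A).card : ℝ) := by
  simp only [aspTh_eq]
  rw [← Finset.sum_product', Finset.sum_boole]
  norm_cast
  refine Finset.card_le_card_of_injOn (fun q => ((μ * (q.2 + d) - d) * β / b', q.1)) ?_ ?_
  · rintro ⟨b, a⟩ hq
    simp only [Finset.coe_filter, Finset.mem_product, Set.mem_ofPred_eq] at hq
    simp only [Finset.coe_filter, Finset.mem_product, Set.mem_ofPred_eq]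
    refine ⟨⟨hq.2.2, hq.1.1⟩, ?_⟩
    rw [div_mul_cancel₀ _ hb]
    have : μ⁻¹ * ((μ * (a + d) - d) * β) + (-(μ⁻¹ * ((μ - 1) * d * β))) = a * β := by
      field_simp; ring
    rw [this]
    exact hq.2.1
  · rintro ⟨b', a⟩ - ⟨b'', a'⟩ - h
    simp only [Prod.mk.injEq, div_left_inj' hb] at h
    have := add_right_cancel (mul_left_cancel₀ hμ (sub_left_injective (mul_right_cancel₀ hβ h.1)))
    rw [h.2, this]

/-- existence of the multiplier -/
lemma asp_mu (A0 C Y : Finset F) (d : F) (hC0 : ∀ c ∈ C, c ≠ 0) (hCne : C.Nonempty)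
    (hY : ∀ a ∈ A0, ∀ c ∈ C, (a + d) * c ∈ Y) (Z : ℝ) (hZ : 0 < Z) (hZA : Z ≤ A0.card)
    (hYZ : 2 * (Y.card : ℝ) ≤ C.card * Z) :
    ∃ μ : F, μ ≠ 0 ∧ μ ≠ 1 ∧
      Z ^ 2 ≤ 2 * Y.card * ((A0.filter fun a => μ * (a + d) - d ∈ A0).card : ℝ) := by
  obtain ⟨c1, hc1, c2, hc2, hne, h⟩ := asp_cs_sets C Y (fun c => A0.image fun a => (a + d) * c)
    (by
      intro c hc y hy
      rw [Finset.mem_image] at hy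
      obtain ⟨a, ha, rfl⟩ := hy
      exact hY a ha c hc) Z hZ hCne (by
      intro c hc
      rw [Finset.card_image_of_injective]
      · exact hZA
      · intro a b hab
        exact add_right_cancel (mul_right_cancel₀ (hC0 c hc) hab)) hYZ
  have h1 := hC0 _ hc1
  have h2 := hC0 _ hc2
  refine ⟨c1 / c2, by positivity, ?_, h.trans ?_⟩
  · intro h; rw [div_eq_one_iff_eq h2] at h; exact hne h
  · refine mul_le_mul_of_nonneg_left (Nat.cast_le.2 ?_) (by positivity)
    refine Finset.card_le_card_of_injOn (fun y => y / c1 - d) ?_ ?_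
    · intro y hy
      simp only [Finset.coe_inter, Finset.coe_image, Set.mem_inter_iff, Set.mem_image, Finset.mem_coe] at hy
      obtain ⟨⟨a, ha, rfl⟩, a', ha', he⟩ := hy
      simp only [Finset.coe_filter, Set.mem_ofPred_eq]
      rw [mul_div_cancel_right₀ _ h1, add_sub_cancel_right]
      refine ⟨ha, ?_⟩
      have : c1 / c2 * (a + d) - d = a' := by
        field_simp
        linear_combination -he
      rwa [this]
    · intro y _ y' _ hyy
      have := sub_left_injective hyy
      rwa [div_left_inj' h1] at this

/-- two-base configuration -/
lemma asp_config (A B C X Y : Finset F) (d : F) (n S : ℝ) (hn : 0 < n) (hS : 0 < S)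
    (hA : (A.card : ℝ) = n) (hB : (B.card : ℝ) ≤ n) (hB2 : n ≤ 2 * B.card) (hC2 : n ≤ 2 * C.card)
    (hB0 : ∀ b ∈ B, b ≠ 0) (hC0 : ∀ c ∈ C, c ≠ 0)
    (hX : ∀ a ∈ A, ∀ b ∈ B, a * b ∈ X) (hY : ∀ a ∈ A, ∀ c ∈ C, (a + d) * c ∈ Y)
    (hXS : (X.card : ℝ) ≤ S) (hYS : (Y.card : ℝ) ≤ S)
    (h1 : 16 * S ≤ 3 * n ^ 2) (h2 : 8 * n ^ 3 ≤ (n ^ 2 / (32 * S)) ^ 4) :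
    ∃ μ : F, μ ≠ 0 ∧ μ ≠ 1 ∧ ∃ β1 ∈ B, ∃ β2 ∈ B, β1 ≠ β2 ∧ ∃ B1 ⊆ B, ∃ B2 ⊆ B,
      B1.Nonempty ∧ B2.Nonempty ∧
      (∀ b ∈ B1, n ^ 7 / (2 ^ 28 * S ^ 5) ≤
        (((A ×ˢ B2).filter fun q => (μ * (q.1 * b) + (μ - 1) * d * β1) / q.2 ∈ A).card : ℝ)) ∧
      (∀ b ∈ B2, n ^ 7 / (2 ^ 28 * S ^ 5) ≤
        (((A ×ˢ B1).filter fun q =>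
          (μ⁻¹ * (q.1 * b) + (-(μ⁻¹ * ((μ - 1) * d * β2)))) / q.2 ∈ A).card : ℝ)) := by
  set t := n ^ 2 / (32 * S) with ht
  have ht0 : 0 < t := by positivity
  have hBpos : (0:ℝ) < B.card := by linarith
  have hCpos : (0:ℝ) < C.card := by linarith
  have hBne : B.Nonempty := by rw [← Finset.card_pos]; exact_mod_cast hBpos
  have hCne : C.Nonempty := by rw [← Finset.card_pos]; exact_mod_cast hCpos
  obtain ⟨A0, hA0, hA0c, hpop⟩ := asp_pop A B X hB0 hX t ht0.le (by
    have : t * X.card ≤ t * S := by gcongr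
    have e : t * S = n ^ 2 / 32 := by rw [ht]; field_simp
    rw [hA]
    nlinarith) hBne
  rw [hA] at hA0c
  obtain ⟨μ, hμ0, hμ1, hm⟩ := asp_mu A0 C Y d hC0 hCne (fun a ha => hY a (hA0 ha)) (3 * n / 4)
    (by positivity) (by linarith) (by nlinarith)
  set A1 := A0.filter fun a => μ * (a + d) - d ∈ A0 with hA1
  have hm' : n ^ 2 / (8 * S) ≤ (A1.card : ℝ) := by
    rw [div_le_iff₀ (by positivity)]
    have : 2 * (Y.card : ℝ) * A1.card ≤ 2 * S * A1.card := by gcongr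
    nlinarith
  have hmpos : (0:ℝ) < A1.card := lt_of_lt_of_le (by positivity) hm'
  set m : ℝ := (A1.card : ℝ) with hmdef
  -- total weight
  have htot : m * (B.card * t ^ 2 / 2) ≤
      ∑ β ∈ B, ∑ q ∈ B ×ˢ B, aspTh A A1 μ d β q.1 q.2 := by
    have e1 : ∑ β ∈ B, ∑ q ∈ B ×ˢ B, aspTh A A1 μ d β q.1 q.2 =
        ∑ a ∈ A1, ∑ β ∈ B, ((B.filter fun b => a * β / b ∈ A).card : ℝ) *
        ((B.filter fun b => (μ * (a + d) - d) * β / b ∈ A).card : ℝ) := by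
      rw [Finset.sum_comm (s := A1)]
      refine Finset.sum_congr rfl fun β _ => ?_
      unfold aspTh
      rw [Finset.sum_comm]
      refine Finset.sum_congr rfl fun a _ => ?_
      rw [Finset.sum_product]
      dsimp only
      exact (Finset.sum_mul_sum B B (fun x => if a * β / x ∈ A then (1:ℝ) else 0)
        (fun y => if (μ * (a + d) - d) * β / y ∈ A then (1:ℝ) else 0)).symm.trans (by simp)
    rw [e1, hmdef, ← nsmul_eq_mul]
    refine Finset.card_nsmul_le_sum _ _ _ fun a ha => ?_
    rw [hA1, Finset.mem_filter] at ha
    linarith [hpop a ha.1 _ ha.2]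
  have hVc : ((B ×ˢ B).card : ℝ) = (B.card : ℝ) ^ 2 := by
    rw [Finset.card_product]; push_cast; ring
  have htn : 8 * (B.card : ℝ) ^ 3 ≤ t ^ 4 := by
    refine le_trans ?_ h2
    gcongr
  obtain ⟨β1, hβ1, β2, hβ2, hne, hβ⟩ := asp_cs_pairs B (B ×ˢ B)
    (fun β q => aspTh A A1 μ d β q.1 q.2) (m * (B.card * t ^ 2 / 2)) (by positivity) htot (by
      have e1 : ∑ β ∈ B, ∑ q ∈ B ×ˢ B, (aspTh A A1 μ d β q.1 q.2) ^ 2 ≤ (B.card : ℝ) * ((B.card : ℝ) ^ 2 * m ^ 2) := by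
        rw [← nsmul_eq_mul]
        refine Finset.sum_le_card_nsmul _ _ _ fun β _ => ?_
        rw [← hVc, ← nsmul_eq_mul]
        refine Finset.sum_le_card_nsmul _ _ _ fun q _ => ?_
        have := aspTh_nonneg A A1 μ d β q.1 q.2
        have h' := aspTh_le A A1 μ d β q.1 q.2
        gcongr
      have e2 : (m * (B.card * t ^ 2 / 2)) ^ 2 ≤ (∑ β ∈ B, ∑ q ∈ B ×ˢ B, aspTh A A1 μ d β q.1 q.2) ^ 2 := by
        gcongr
      refine le_trans ?_ e2
      rw [hVc]
      calc _ ≤ 2 * (B.card : ℝ) ^ 2 * ((B.card : ℝ) * ((B.card : ℝ) ^ 2 * m ^ 2)) := by gcongr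
        _ = (m ^ 2 * (B.card : ℝ) ^ 2 / 4) * (8 * (B.card : ℝ) ^ 3) := by ring
        _ ≤ (m ^ 2 * (B.card : ℝ) ^ 2 / 4) * t ^ 4 := by gcongr
        _ = _ := by ring)
  simp only [hVc] at hβ
  have hT' : m ^ 2 * t ^ 4 / (8 * n ^ 2) ≤
      ∑ b ∈ B, ∑ b' ∈ B, aspTh A A1 μ d β1 b b' * aspTh A A1 μ d β2 b b' := by
    rw [← Finset.sum_product']
    set Q := ∑ q ∈ B ×ˢ B, aspTh A A1 μ d β1 q.1 q.2 * aspTh A A1 μ d β2 q.1 q.2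
    have hQ0 : 0 ≤ Q := Finset.sum_nonneg fun _ _ => mul_nonneg (aspTh_nonneg ..) (aspTh_nonneg ..)
    have g1 : (B.card : ℝ) ^ 2 * (m ^ 2 * t ^ 4) ≤ (B.card : ℝ) ^ 2 * (8 * (B.card : ℝ) ^ 2 * Q) := by
      nlinarith
    have g2 := le_of_mul_le_mul_left g1 (by positivity)
    rw [div_le_iff₀ (by positivity)]
    refine g2.trans ?_
    have : 8 * (B.card : ℝ) ^ 2 * Q ≤ 8 * n ^ 2 * Q := by gcongr
    linarith
  obtain ⟨B1, hB1, B2, hB2', hB1ne, hB2ne, hd1, hd2⟩ := asp_prune B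
    (fun b b' => aspTh A A1 μ d β1 b b' * aspTh A A1 μ d β2 b b') _ (by positivity) hT'
    (m ^ 2 * t ^ 4 / (32 * n ^ 3)) (by positivity) (by
      calc _ ≤ 4 * n * (m ^ 2 * t ^ 4 / (32 * n ^ 3)) := by gcongr
        _ = _ := by field_simp; norm_num)
  have hZ : n ^ 7 / (2 ^ 28 * S ^ 5) ≤ m * t ^ 4 / (32 * n ^ 3) := by
    calc n ^ 7 / (2 ^ 28 * S ^ 5) = (n ^ 2 / (8 * S)) * t ^ 4 / (32 * n ^ 3) := by
          rw [ht]; field_simp; norm_num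
      _ ≤ _ := by gcongr
  refine ⟨μ, hμ0, hμ1, β1, hβ1, β2, hβ2, hne, B1, hB1, B2, hB2', hB1ne, hB2ne, ?_, ?_⟩
  · intro b hb
    refine hZ.trans (le_trans ?_ (aspTh_deg1 A A1 B2 μ d β1 b (hB0 _ hβ1) (hB0 _ (hB1 hb))))
    have g := hd1 b hb
    have g2 : ∑ b' ∈ B2, aspTh A A1 μ d β1 b b' * aspTh A A1 μ d β2 b b' ≤
        m * ∑ b' ∈ B2, aspTh A A1 μ d β1 b b' := by
      rw [Finset.mul_sum]
      refine Finset.sum_le_sum fun b' _ => ?_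
      rw [mul_comm]
      exact mul_le_mul_of_nonneg_right (aspTh_le ..) (aspTh_nonneg ..)
    refine le_of_mul_le_mul_left ?_ hmpos
    refine le_trans (le_of_eq ?_) (g.trans g2)
    ring
  · intro b hb
    refine hZ.trans (le_trans ?_ (aspTh_deg2 A A1 B1 μ d β2 b hμ0 (hB0 _ hβ2) (hB0 _ (hB2' hb))))
    have g := hd2 b hb
    have g2 : ∑ b' ∈ B1, aspTh A A1 μ d β1 b' b * aspTh A A1 μ d β2 b' b ≤
        m * ∑ b' ∈ B1, aspTh A A1 μ d β2 b' b := by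
      rw [Finset.mul_sum]
      refine Finset.sum_le_sum fun b' _ => ?_
      exact mul_le_mul_of_nonneg_right (aspTh_le ..) (aspTh_nonneg ..)
    refine le_of_mul_le_mul_left ?_ hmpos
    refine le_trans (le_of_eq ?_) (g.trans g2)
    ring
end

section
variable {F : Type*} [Field F] [DecidableEq F]

lemma asp_step_sum (A B1 B2 C Y : Finset F) (d : F) (hd : d ≠ 0)
    (hY : ∀ a ∈ A, ∀ c ∈ C, (a + d) * c ∈ Y) (hC0 : ∀ c ∈ C, c ≠ 0)
    (hB1 : ∀ b ∈ B1, b ≠ 0) (hB2 : ∀ b ∈ B2, b ≠ 0) (u v : F) (hu : u ≠ 0)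
    (Z n S : ℝ) (hZ : 0 < Z) (hn : 0 < n) (hS : 0 < S) (hYS : (Y.card : ℝ) ≤ S)
    (hB2n : (B2.card : ℝ) ≤ n) (hCn : n ≤ 2 * C.card)
    (hdeg : ∀ b ∈ B1, Z ≤ (((A ×ˢ B2).filter fun q => (u * (q.1 * b) + v) / q.2 ∈ A).card : ℝ))
    (ξ : F) (hξ : ∃ s, 2 * (S * n) ≤ ((aspFib B1 C d ξ s).card : ℝ) * Z) :
    ∃ ρ : F, ρ ≠ 0 ∧ ρ ≠ 1 ∧ Z ^ 2 ≤ 4 * S *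
      ∑ q ∈ Y ×ˢ Y, ((aspFib B2 C d (u * ξ + v) ((q.1 - ρ * q.2) / (1 - ρ))).card : ℝ) := by
  obtain ⟨s, hs⟩ := hξ
  have hYB : (Y.card : ℝ) * B2.card ≤ S * n := by gcongr
  obtain ⟨ρ, h0, h1, h⟩ := asp_step A B1 B2 C Y d hd hY hC0 hB1 hB2 u v hu Z hZ hdeg ξ s (by
    rw [← Finset.card_pos]
    by_contra hcon
    have : (aspFib B1 C d ξ s).card = 0 := by omega
    rw [this] at hs
    have : 0 < S * n := by positivity
    push_cast at hs
    linarith) (by linarith)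
  refine ⟨ρ, h0, h1, ?_⟩
  set Q := ∑ q ∈ Y ×ˢ Y, ((aspFib B2 C d (u * ξ + v) ((q.1 - ρ * q.2) / (1 - ρ))).card : ℝ)
  have hQ : 0 ≤ Q := Finset.sum_nonneg fun _ _ => by positivity
  have h2 : 2 * ((Y.card : ℝ) * B2.card) * Q ≤ 2 * (S * n) * Q := by gcongr
  have h3 : n * Z ^ 2 ≤ 2 * C.card * Z ^ 2 := by gcongr
  have h4 : n * Z ^ 2 ≤ n * (4 * S * Q) := by nlinarith
  exact le_of_mul_le_mul_left h4 hn

lemma asp_step_G (A B1 B2 C Y : Finset F) (d : F) (hd : d ≠ 0)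
    (hY : ∀ a ∈ A, ∀ c ∈ C, (a + d) * c ∈ Y) (hC0 : ∀ c ∈ C, c ≠ 0)
    (hB1 : ∀ b ∈ B1, b ≠ 0) (hB2 : ∀ b ∈ B2, b ≠ 0) (u v : F) (hu : u ≠ 0)
    (Z n S : ℝ) (hZ : 0 < Z) (hn : 0 < n) (hS : 0 < S) (hYS : (Y.card : ℝ) ≤ S)
    (hB2n : (B2.card : ℝ) ≤ n) (hCn : n ≤ 2 * C.card) (hZ3 : 8 * S ^ 4 * n ≤ Z ^ 3)
    (hdeg : ∀ b ∈ B1, Z ≤ (((A ×ˢ B2).filter fun q => (u * (q.1 * b) + v) / q.2 ∈ A).card : ℝ))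
    (ξ : F) (hξ : ∃ s, 2 * (S * n) ≤ ((aspFib B1 C d ξ s).card : ℝ) * Z) :
    ∃ s, 2 * (S * n) ≤ ((aspFib B2 C d (u * ξ + v) s).card : ℝ) * Z := by
  obtain ⟨ρ, h0, h1, h⟩ := asp_step_sum A B1 B2 C Y d hd hY hC0 hB1 hB2 u v hu Z n S hZ hn hS hYS
    hB2n hCn hdeg ξ hξ
  have hYne : Y.Nonempty := by
    by_contra hcon
    rw [Finset.not_nonempty_iff_eq_empty] at hcon
    rw [hcon] at h
    simp at h
    exact hZ.ne' h
  obtain ⟨ω, hω⟩ := asp_cor_a B2 C Y d (u * ξ + v) ρ hYne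
  refine ⟨ω, ?_⟩
  set f : ℝ := ((aspFib B2 C d (u * ξ + v) ω).card : ℝ) with hf
  have hf0 : 0 ≤ f := by positivity
  have g1 : Z ^ 2 ≤ 4 * S * (S ^ 2 * f) := by
    refine h.trans ?_
    have : (Y.card : ℝ) ^ 2 * f ≤ S ^ 2 * f := by gcongr
    have := hω.trans this
    gcongr
  have g2 : Z ^ 3 ≤ 4 * S * (S ^ 2 * f) * Z := by
    calc Z ^ 3 = Z ^ 2 * Z := by ring
      _ ≤ _ := by gcongr
  have g3 : (4 * S ^ 3) * (2 * (S * n)) ≤ (4 * S ^ 3) * (f * Z) := by nlinarith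
  exact le_of_mul_le_mul_left g3 (by positivity)

end

set_option maxHeartbeats 1000000 in
lemma asp_close (p : ℕ) [Fact p.Prime] (A B1 B2 C Y : Finset (ZMod p)) (d : ZMod p) (hd : d ≠ 0)
    (hY : ∀ a ∈ A, ∀ c ∈ C, (a + d) * c ∈ Y) (hC0 : ∀ c ∈ C, c ≠ 0)
    (hB1 : ∀ b ∈ B1, b ≠ 0) (hB2 : ∀ b ∈ B2, b ≠ 0) (hB2ne : B2.Nonempty)
    (μ β1 β2 : ZMod p) (hμ0 : μ ≠ 0) (hμ1 : μ ≠ 1) (hβ : β1 ≠ β2)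
    (Z n S : ℝ) (hZ : 0 < Z) (hn : 0 < n) (hS : 0 < S) (hYS : (Y.card : ℝ) ≤ S)
    (hA : (A.card : ℝ) = n)
    (hB1n : (B1.card : ℝ) ≤ n) (hB2n : (B2.card : ℝ) ≤ n) (hCn : n ≤ 2 * C.card)
    (hCn' : (C.card : ℝ) ≤ n) (hp : n ^ 2 ≤ p)
    (hZ3 : 8 * S ^ 4 * n ≤ Z ^ 3) (hZ2 : 2 * S * n ^ 2 ≤ Z ^ 2)
    (hdeg1 : ∀ b ∈ B1, Z ≤
      (((A ×ˢ B2).filter fun q => (μ * (q.1 * b) + (μ - 1) * d * β1) / q.2 ∈ A).card : ℝ))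
    (hdeg2 : ∀ b ∈ B2, Z ≤ (((A ×ˢ B1).filter fun q =>
          (μ⁻¹ * (q.1 * b) + (-(μ⁻¹ * ((μ - 1) * d * β2)))) / q.2 ∈ A).card : ℝ)) :
    Z ^ 4 ≤ 32 * n ^ 2 * S ^ 5 := by
  set G : ZMod p → Prop := fun ξ => ∃ s, 2 * (S * n) ≤ ((aspFib B1 C d ξ s).card : ℝ) * Z with hG
  set τ := (μ - 1) * d * (β1 - β2) / μ with hτ
  have hτ0 : τ ≠ 0 := by
    rw [hτ]
    exact div_ne_zero (mul_ne_zero (mul_ne_zero (sub_ne_zero.2 hμ1) hd) (sub_ne_zero.2 hβ)) hμ0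
  have hstep : ∀ ξ, G ξ → G (ξ + τ) := by
    intro ξ hξ
    have g1 := asp_step_G A B1 B2 C Y d hd hY hC0 hB1 hB2 μ ((μ - 1) * d * β1) hμ0 Z n S hZ hn hS
      hYS hB2n hCn hZ3 hdeg1 ξ hξ
    have g2 := asp_step_G A B2 B1 C Y d hd hY hC0 hB2 hB1 μ⁻¹ (-(μ⁻¹ * ((μ - 1) * d * β2)))
      (inv_ne_zero hμ0) Z n S hZ hn hS hYS hB1n hCn hZ3 hdeg2 _ g1
    have : μ⁻¹ * (μ * ξ + (μ - 1) * d * β1) + -(μ⁻¹ * ((μ - 1) * d * β2)) = ξ + τ := by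
      rw [hτ]; field_simp; ring
    rw [this] at g2
    exact g2
  have h0 : G 0 := by
    obtain ⟨b, hb⟩ := hB2ne
    have hCpos : 0 < C.card := by
      have : (0:ℝ) < C.card := by linarith
      exact_mod_cast this
    obtain ⟨c, hc⟩ := Finset.card_pos.1 hCpos
    refine ⟨c * d, ?_⟩
    have e1 : Z ≤ n * B1.card := by
      refine (hdeg2 b hb).trans ?_
      rw [← hA]
      have := Finset.card_filter_le (A ×ˢ B1) (fun q =>
          (μ⁻¹ * (q.1 * b) + (-(μ⁻¹ * ((μ - 1) * d * β2)))) / q.2 ∈ A)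
      rw [Finset.card_product] at this
      exact_mod_cast this
    have e2 : (B1.card : ℝ) ≤ (aspFib B1 C d 0 (c * d)).card := by
      norm_cast
      refine Finset.card_le_card_of_injOn (fun b => (b, c)) ?_ ?_
      · intro b hb
        simp only [aspFib, Finset.coe_filter, Finset.mem_product, Set.mem_ofPred_eq]
        exact ⟨⟨hb, hc⟩, by simp⟩
      · intro x _ y _ h
        exact (Prod.mk.inj h).1
    have e3 : n * (2 * (S * n)) ≤ n * ((aspFib B1 C d 0 (c * d)).card * Z) := by
      calc n * (2 * (S * n)) = 2 * S * n ^ 2 := by ring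
        _ ≤ Z ^ 2 := hZ2
        _ = Z * Z := by ring
        _ ≤ (n * B1.card) * Z := by gcongr
        _ ≤ (n * (aspFib B1 C d 0 (c * d)).card) * Z := by gcongr
        _ = _ := by ring
    exact le_of_mul_le_mul_left e3 hn
  have hk : ∀ k : ℕ, G (k * τ) := by
    intro k
    induction k with
    | zero => simpa using h0
    | succ k ih =>
      have := hstep _ ih
      have e : ((k + 1 : ℕ) : ZMod p) * τ = k * τ + τ := by push_cast; ring
      rw [e]; exact this
  have hall : ∀ ξ, G ξ := by
    intro ξ
    have := hk (ξ / τ).val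
    rwa [ZMod.natCast_zmod_val, div_mul_cancel₀ _ hτ0] at this
  have hBC : (B2.card : ℝ) * C.card ≤ n ^ 2 := by rw [sq]; gcongr
  obtain ⟨x, hx⟩ := asp_avg B2 C d hd hB2 hC0 (by
    rw [ZMod.card]
    exact_mod_cast hBC.trans hp)
  obtain ⟨ρ, hρ0, hρ1, h⟩ := asp_step_sum A B1 B2 C Y d hd hY hC0 hB1 hB2 μ ((μ - 1) * d * β1) hμ0
    Z n S hZ hn hS hYS hB2n hCn hdeg1 _ (hall ((x - (μ - 1) * d * β1) / μ))
  have hxe : μ * ((x - (μ - 1) * d * β1) / μ) + (μ - 1) * d * β1 = x := by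
    rw [mul_div_cancel₀ _ hμ0, sub_add_cancel]
  rw [hxe] at h
  have hb := asp_cor_b B2 C Y d x ρ hρ0 hρ1
  set Q := ∑ q ∈ Y ×ˢ Y, ((aspFib B2 C d x ((q.1 - ρ * q.2) / (1 - ρ))).card : ℝ)
  have hQ2 : Q ^ 2 ≤ S ^ 3 * (2 * n ^ 2) := by
    refine hb.trans ?_
    have : ∑ ω : ZMod p, ((aspFib B2 C d x ω).card : ℝ) ^ 2 ≤ 2 * n ^ 2 := by linarith
    exact mul_le_mul (pow_le_pow_left₀ (by positivity) hYS 3) this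
      (Finset.sum_nonneg fun _ _ => by positivity) (by positivity)
  calc Z ^ 4 = (Z ^ 2) ^ 2 := by ring
    _ ≤ (4 * S * Q) ^ 2 := by gcongr
    _ = 16 * S ^ 2 * Q ^ 2 := by ring
    _ ≤ 16 * S ^ 2 * (S ^ 3 * (2 * n ^ 2)) := by gcongr
    _ = _ := by ring

lemma asp_main (p : ℕ) [Fact p.Prime] (A B C X Y : Finset (ZMod p)) (d : ZMod p) (hd : d ≠ 0)
    (n S : ℝ) (hn : 0 < n) (hnS : n ≤ S)
    (hA : (A.card : ℝ) = n) (hB : (B.card : ℝ) ≤ n) (hB2 : n ≤ 2 * B.card)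
    (hC : (C.card : ℝ) ≤ n) (hC2 : n ≤ 2 * C.card)
    (hB0 : ∀ b ∈ B, b ≠ 0) (hC0 : ∀ c ∈ C, c ≠ 0)
    (hX : ∀ a ∈ A, ∀ b ∈ B, a * b ∈ X) (hY : ∀ a ∈ A, ∀ c ∈ C, (a + d) * c ∈ Y)
    (hXS : (X.card : ℝ) ≤ S) (hYS : (Y.card : ℝ) ≤ S) (hp : n ^ 2 ≤ p) :
    n ^ 26 ≤ 2 ^ 117 * S ^ 25 := by
  by_contra! hcon
  have hS : 0 < S := hn.trans_le hnS
  have hj : ∀ j ≤ 25, 2 ^ 117 * S ^ j ≤ n ^ (j + 1) := by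
    intro j hj
    have e1 : n ^ 26 ≤ n ^ (j + 1) * S ^ (25 - j) := by
      have : n ^ 26 = n ^ (j + 1) * n ^ (25 - j) := by
        rw [← pow_add]; congr 1; omega
      rw [this]; gcongr
    have e2 : S ^ 25 = S ^ j * S ^ (25 - j) := by
      rw [← pow_add]; congr 1; omega
    have e3 : (2 ^ 117 * S ^ j) * S ^ (25 - j) ≤ n ^ (j + 1) * S ^ (25 - j) := by
      rw [mul_assoc, ← e2]; exact hcon.le.trans e1
    exact le_of_mul_le_mul_right e3 (by positivity)
  have j1 := hj 1 (by norm_num)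
  have j4 := hj 4 (by norm_num)
  have j19 := hj 19 (by norm_num)
  have j11 := hj 11 (by norm_num)
  norm_num at j1 j4 j19 j11
  have p4 : 0 < S ^ 4 := by positivity
  have p19 : 0 < S ^ 19 := by positivity
  have p11 : 0 < S ^ 11 := by positivity
  obtain ⟨μ, hμ0, hμ1, β1, hβ1, β2, hβ2, hβ, B1, hB1, B2, hB2', hB1ne, hB2ne, hd1, hd2⟩ :=
    asp_config A B C X Y d n S hn hS hA hB hB2 hC2 hB0 hC0 hX hY hXS hYS (by linarith) (by
      rw [div_pow, le_div_iff₀ (by positivity)]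
      calc 8 * n ^ 3 * (32 * S) ^ 4 = n ^ 3 * (2 ^ 23 * S ^ 4) := by ring
        _ ≤ n ^ 3 * n ^ 5 := by gcongr; linarith
        _ = _ := by ring)
  have hc1 : (B1.card : ℝ) ≤ n := le_trans (by exact_mod_cast Finset.card_le_card hB1) hB
  have hc2 : (B2.card : ℝ) ≤ n := le_trans (by exact_mod_cast Finset.card_le_card hB2') hB
  have hfin := asp_close p A B1 B2 C Y d hd hY hC0 (fun b hb => hB0 b (hB1 hb))
    (fun b hb => hB0 b (hB2' hb)) hB2ne μ β1 β2 hμ0 hμ1 hβ (n ^ 7 / (2 ^ 28 * S ^ 5)) n S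
    (by positivity) hn hS hYS hA hc1 hc2 hC2 hC hp (by
      rw [div_pow, le_div_iff₀ (by positivity)]
      calc 8 * S ^ 4 * n * (2 ^ 28 * S ^ 5) ^ 3 = n * (2 ^ 87 * S ^ 19) := by ring
        _ ≤ n * n ^ 20 := by gcongr; linarith
        _ = _ := by ring) (by
      rw [div_pow, le_div_iff₀ (by positivity)]
      calc 2 * S * n ^ 2 * (2 ^ 28 * S ^ 5) ^ 2 = n ^ 2 * (2 ^ 57 * S ^ 11) := by ring
        _ ≤ n ^ 2 * n ^ 12 := by gcongr; linarith
        _ = _ := by ring) hd1 hd2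
  rw [div_pow, div_le_iff₀ (by positivity)] at hfin
  have : n ^ 2 * n ^ 26 ≤ n ^ 2 * (2 ^ 117 * S ^ 25) := by
    calc n ^ 2 * n ^ 26 = (n ^ 7) ^ 4 := by ring
      _ ≤ _ := hfin
      _ = _ := by ring
  exact absurd (le_of_mul_le_mul_left this (by positivity)) (not_le.2 hcon)

lemma asp_final (n S : ℝ) (hn : 1 ≤ n) (hS : 0 ≤ S) (h : n ^ 26 ≤ 2 ^ 117 * S ^ 25) :
    (1 / 2 ^ 5 : ℝ) * n ^ ((1 : ℝ) + 1 / 26) ≤ S := by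
  have h1 : n ^ ((1 : ℝ) + 1 / 26) ≤ n ^ ((26 : ℝ) / 25) :=
    Real.rpow_le_rpow_of_exponent_le hn (by norm_num)
  have h2 : (n ^ ((26 : ℝ) / 25)) ^ 25 = n ^ 26 := by
    rw [← Real.rpow_natCast, ← Real.rpow_mul (by linarith), ← Real.rpow_natCast]
    norm_num
  refine (mul_le_mul_of_nonneg_left h1 (by norm_num)).trans ?_
  refine le_of_pow_le_pow_left₀ (n := 25) (by norm_num) hS ?_
  rw [mul_pow, h2]
  have : 0 ≤ S ^ 25 := by positivity
  norm_num
  norm_num at h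
  linarith



/-- Theorem 1 (main): for `A, B, C ⊆ 𝔽_p` with `|A| = |B| = |C| ≤ √p` and `d ≠ 0`,
`max(|A·B|, |(A+d)·C|) ≫ |A|^(1+1/26)`. -/
theorem additive_shift_product_bound :
    ∃ c : ℝ, 0 < c ∧ ∀ (p : ℕ), p.Prime → ∀ (A B C : Finset (ZMod p)) (d : ZMod p),
      d ≠ 0 → A.card = B.card → A.card = C.card →
      (A.card : ℝ) ≤ Real.sqrt p →
      c * (A.card : ℝ) ^ ((1 : ℝ) + 1 / 26) ≤
        max ((A * B).card : ℝ) (((A + {d}) * C).card : ℝ) := by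
 
  refine ⟨1 / 2 ^ 5, by norm_num, ?_⟩
  intro p hp A B C d hd hAB hAC hsq
  have : Fact p.Prime := ⟨hp⟩
  set S : ℝ := max ((A * B).card : ℝ) (((A + {d}) * C).card : ℝ) with hSdef
  have hS0 : 0 ≤ S := le_max_of_le_left (by positivity)
  rcases Nat.lt_or_ge A.card 2 with hlt | hge
  · interval_cases hA : A.card
    · simp only [Nat.cast_zero]
      rw [Real.zero_rpow (by norm_num), mul_zero]
      exact hS0
    · have h1 : 0 < (A * B).card := by
        rw [Finset.card_pos]
        exact Finset.Nonempty.mul (Finset.card_pos.1 (by omega)) (Finset.card_pos.1 (by omega))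
      have h2 : (1:ℝ) ≤ S := le_max_of_le_left (by exact_mod_cast h1)
      simp only [Nat.cast_one, Real.one_rpow]
      linarith
  · have hBe : A.card ≤ (B.erase 0).card + 1 := by
      rw [hAB]; 
      have := Finset.pred_card_le_card_erase (s := B) (a := 0)
      omega
    have hCe : A.card ≤ (C.erase 0).card + 1 := by
      rw [hAC]; 
      have := Finset.pred_card_le_card_erase (s := C) (a := 0)
      omega
    have hBl : (B.erase 0).card ≤ A.card := by rw [hAB]; exact Finset.card_erase_le
    have hCl : (C.erase 0).card ≤ A.card := by rw [hAC]; exact Finset.card_erase_le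
    have hn : (2:ℝ) ≤ A.card := by exact_mod_cast hge
    have hnS : (A.card : ℝ) ≤ S := by
      refine le_max_of_le_left ?_
      obtain ⟨b, hb⟩ := Finset.card_pos.1 (show 0 < (B.erase 0).card by omega)
      rw [Finset.mem_erase] at hb
      norm_cast
      refine Finset.card_le_card_of_injOn (fun a => a * b) ?_ ?_
      · intro a ha
        exact Finset.mul_mem_mul ha hb.2
      · intro x _ y _ h
        exact mul_right_cancel₀ hb.1 h
    refine asp_final _ S (by linarith) hS0 ?_
    have hXS : ((A * B).card : ℝ) ≤ S := le_max_left _ _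
    have hYS : (((A + {d}) * C).card : ℝ) ≤ S := le_max_right _ _
    clear_value S
    have a1 : ((B.erase 0).card : ℝ) ≤ A.card := by exact_mod_cast hBl
    have a2 : (A.card : ℝ) ≤ 2 * (B.erase 0).card := by
      exact_mod_cast (by omega : A.card ≤ 2 * (B.erase 0).card)
    have a3 : ((C.erase 0).card : ℝ) ≤ A.card := by exact_mod_cast hCl
    have a4 : (A.card : ℝ) ≤ 2 * (C.erase 0).card := by
      exact_mod_cast (by omega : A.card ≤ 2 * (C.erase 0).card)
    have a5 : (A.card : ℝ) ^ 2 ≤ (p : ℝ) := by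
      calc (A.card : ℝ) ^ 2 ≤ (Real.sqrt p) ^ 2 := by gcongr
        _ = (p : ℝ) := Real.sq_sqrt (by positivity)
    have a6 : ∀ a ∈ A, ∀ b ∈ B.erase 0, a * b ∈ A * B := by
      intro a ha b hb
      exact Finset.mul_mem_mul ha (Finset.mem_erase.1 hb).2
    have a7 : ∀ a ∈ A, ∀ c ∈ C.erase 0, (a + d) * c ∈ (A + {d}) * C := by
      intro a ha c hc
      exact Finset.mul_mem_mul (Finset.add_mem_add ha (Finset.mem_singleton_self d))
        (Finset.mem_erase.1 hc).2
    have a8 : ∀ b ∈ B.erase 0, b ≠ 0 := fun b hb => (Finset.mem_erase.1 hb).1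
    have a9 : ∀ c ∈ C.erase 0, c ≠ 0 := fun b hb => (Finset.mem_erase.1 hb).1
    generalize A * B = X at *
    generalize (A + {d}) * C = Y at *
    generalize B.erase 0 = B' at *
    generalize C.erase 0 = C' at *
    have h0 : (0:ℝ) < A.card := by linarith
    exact asp_main p A B' C' X Y d hd (A.card : ℝ) S h0 hnS rfl a1 a2 a3 a4 a8 a9 a6 a7 hXS hYS a5
end

section
/- For any finite subset A of 𝔽_p with |A| ≤ √p, one has |A·(A+1)| ≫ |A|^{1 + 1/26}. -/
open Pointwise

lemma cs_card {ι κ : Type*} [DecidableEq κ] (T : Finset ι) (R : Finset κ) (g : ι → κ)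
    (hg : ∀ i ∈ T, g i ∈ R) :
    (T.card : ℝ) ^ 2 ≤ R.card * ((T ×ˢ T).filter fun z => g z.1 = g z.2).card := by
  have h1 : (T.card : ℝ) = ∑ c ∈ R, ((T.filter fun i => g i = c).card : ℝ) := by
    rw [Finset.card_eq_sum_card_fiberwise (f := g) (t := R) (fun i hi => hg i hi)]
    push_cast; rfl
  have h2 : (((T ×ˢ T).filter fun z => g z.1 = g z.2).card : ℝ)
      = ∑ c ∈ R, ((T.filter fun i => g i = c).card : ℝ) ^ 2 := by
    rw [Finset.card_eq_sum_card_fiberwise (f := fun z : ι × ι => g z.1) (t := R)]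
    · push_cast
      refine Finset.sum_congr rfl fun c _ => ?_
      rw [sq, ← Nat.cast_mul, ← Finset.card_product]
      congr 2
      ext ⟨a, b⟩
      simp only [Finset.mem_filter, Finset.mem_product]
      constructor
      · rintro ⟨⟨⟨h1, h2⟩, h3⟩, h4⟩; exact ⟨⟨h1, h4⟩, h2, h3 ▸ h4⟩
      · rintro ⟨⟨h1, h2⟩, h3, h4⟩; exact ⟨⟨⟨h1, h3⟩, h2.trans h4.symm⟩, h2⟩
    · intro z hz
      simp only [Finset.coe_filter, Finset.mem_product, Set.mem_ofPred_eq] at hz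
      exact hg _ hz.1.1
  rw [h1, h2]
  exact sq_sum_le_card_mul_sum_sq

section
set_option linter.unusedSectionVars false
variable {F : Type*} [Field F] [Fintype F] [DecidableEq F]

/-- value at `f` of the line with parameters `t` -/
def lev (f : F) (t : F × F) : F := t.1 * (f / t.2 + 1)

def Pset (A B2 : Finset F) (h : F → F) (b : F) : Finset (F × F) :=
  (Finset.univ ×ˢ B2).filter fun z => z.1 / b ∈ A ∧ h z.1 / z.2 ∈ A

def Tset (A B2 : Finset F) (h : F → F) (t t' : F × F) : Finset ((F × F) × F) :=
  ((Finset.univ ×ˢ Finset.univ) ×ˢ B2).filter fun z =>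
    (z.1.1 / t.2 ∈ A ∧ h z.1.1 / z.2 ∈ A) ∧ (z.1.2 / t'.2 ∈ A ∧ h z.1.2 / z.2 ∈ A) ∧
    lev z.1.1 t = lev z.1.2 t'

lemma lev_inj {x x' : F} {t : F × F} (h1 : t.1 ≠ 0) (h2 : t.2 ≠ 0) (h : lev x t = lev x' t) :
    x = x' := by
  unfold lev at h
  have := mul_left_cancel₀ h1 h
  have := add_right_cancel this
  field_simp at this
  exact this

lemma good_pair (A B C B2 : Finset F) (hA : ∀ a ∈ A, a ≠ 0) (hB : ∀ b ∈ B, b ≠ 0)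
    (hC : ∀ s ∈ A, ∀ a ∈ A, s * (a + 1) ∈ C) (n W : ℝ) (hn : 0 < n) (hB2 : (B2.card : ℝ) ≤ n)
    (hW : 0 < W) (h : F → F) (V : Finset (F × F)) (hV : V ⊆ A ×ˢ B)
    (hC0 : 0 < (C.card : ℝ))
    (hVW : ∀ t ∈ V, W ≤ (Pset A B2 h t.2).card)
    (hbig : 2 * C.card * n ≤ V.card * W) :
    ∃ t ∈ V, ∃ t' ∈ V, t ≠ t' ∧ W ^ 2 / (2 * C.card * n) ≤ (Tset A B2 h t t').card := by
  by_contra hcon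
  push Not at hcon
  set q : ℝ := (C.card : ℝ)
  set θ := W ^ 2 / (2 * q * n) with hθ
  have hθ0 : 0 < θ := by positivity
  let T : Finset ((F × F) × (F × F)) :=
    (V ×ˢ (Finset.univ ×ˢ B2)).filter fun z => z.2 ∈ Pset A B2 h z.1.2
  have hZ : (T.card : ℝ) = ∑ t ∈ V, ((Pset A B2 h t.2).card : ℝ) := by
    rw [Finset.card_eq_sum_card_fiberwise (f := fun z => z.1) (t := V)]
    · push_cast
      refine Finset.sum_congr rfl fun t ht => ?_
      congr 1
      refine Finset.card_bij (fun z _ => z.2) ?_ ?_ ?_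
      · rintro ⟨a, b⟩ hz; simp [T] at hz; obtain ⟨hz, rfl⟩ := hz; exact hz.2
      · rintro ⟨a, b⟩ hz ⟨a', b'⟩ hz' hh
        simp [T] at hz hz' hh ⊢
        exact ⟨hz.2.trans hz'.2.symm, hh⟩
      · intro b hb
        refine ⟨(t, b), ?_, rfl⟩
        have : b.2 ∈ B2 := by
          simp [Pset] at hb; exact hb.1
        simp [T, ht, hb, this]
    · intro z hz; simp [T] at hz; exact hz.1.1
  have hcs := cs_card T (C ×ˢ B2) (fun z => (lev z.2.1 z.1, z.2.2)) (by
    rintro ⟨t, z⟩ hz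
    simp [T, Pset] at hz
    have := hV hz.1.1
    simp at this
    simp [lev]
    exact ⟨hC _ this.1 _ hz.2.2.1, hz.1.2⟩)
  have hcnt : (((T ×ˢ T).filter fun z => (lev z.1.2.1 z.1.1, z.1.2.2) = (lev z.2.2.1 z.2.1, z.2.2.2)).card : ℝ)
      ≤ ∑ p ∈ V ×ˢ V, ((Tset A B2 h p.1 p.2).card : ℝ) := by
    rw [Finset.card_eq_sum_card_fiberwise (f := fun z => (z.1.1, z.2.1)) (t := V ×ˢ V)]
    · push_cast
      refine Finset.sum_le_sum fun p hp => ?_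
      norm_cast
      refine Finset.card_le_card_of_injOn (fun z => ((z.1.2.1, z.2.2.1), z.1.2.2)) ?_ ?_
      · rintro ⟨⟨t, x, b⟩, ⟨t', x', b'⟩⟩ hz
        simp [T, Pset] at hz
        obtain ⟨⟨⟨⟨⟨h1, h2⟩, h3⟩, ⟨h4, h5⟩, h6⟩, h7, rfl⟩, rfl⟩ := hz
        simp [Tset]
        tauto
      · rintro ⟨⟨t, x, b⟩, ⟨t', x', b'⟩⟩ hz ⟨⟨u, y, c⟩, ⟨u', y', c'⟩⟩ hz' hh
        simp [T] at hz hz' hh ⊢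
        obtain ⟨⟨_, _, rfl⟩, rfl⟩ := hz
        obtain ⟨⟨_, _, rfl⟩, h2⟩ := hz'
        simp at h2
        obtain ⟨rfl, rfl⟩ := h2
        tauto
    · intro z hz
      simp [T] at hz ⊢
      tauto
  have hdiag : ∀ t ∈ V, ((Tset A B2 h t t).card : ℝ) ≤ (Pset A B2 h t.2).card := by
    intro t ht
    norm_cast
    have := hV ht
    simp at this
    refine Finset.card_le_card_of_injOn (fun z => (z.1.1, z.2)) ?_ ?_
    · rintro ⟨⟨x, x'⟩, b⟩ hz
      simp [Tset] at hz
      simp [Pset]; tauto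
    · rintro ⟨⟨x, x'⟩, b⟩ hz ⟨⟨y, y'⟩, c⟩ hz' hh
      simp [Tset] at hz hz' hh ⊢
      have e1 := lev_inj (hA _ this.1) (hB _ this.2) hz.2.2.2
      have e2 := lev_inj (hA _ this.1) (hB _ this.2) hz'.2.2.2
      obtain ⟨rfl, rfl⟩ := hh
      exact ⟨⟨rfl, e1 ▸ e2⟩, rfl⟩
  have hVne : V.Nonempty := by
    rw [Finset.nonempty_iff_ne_empty]
    rintro rfl
    simp at hbig
    nlinarith [mul_pos hC0 hn]
  have hVpos : 0 < (V.card : ℝ) := by exact_mod_cast hVne.card_pos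
  have hsum : ∑ p ∈ V ×ˢ V, ((Tset A B2 h p.1 p.2).card : ℝ)
      ≤ T.card + ((V.card : ℝ) ^ 2 - V.card) * θ := by
    rw [Finset.sum_product, hZ]
    have : ∀ t ∈ V, ∑ t' ∈ V, ((Tset A B2 h t t').card : ℝ)
        ≤ (Pset A B2 h t.2).card + ((V.card : ℝ) - 1) * θ := by
      intro t ht
      rw [← Finset.add_sum_erase _ _ ht]
      refine add_le_add (hdiag t ht) ?_
      calc _ ≤ ∑ t' ∈ V.erase t, θ := Finset.sum_le_sum fun t' ht' =>
            (hcon t ht t' (Finset.mem_of_mem_erase ht') (Finset.ne_of_mem_erase ht').symm).le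
        _ = _ := by
          rw [Finset.sum_const, Finset.card_erase_of_mem ht, nsmul_eq_mul,
            Nat.cast_sub hVne.card_pos]; simp
    refine (Finset.sum_le_sum this).trans ?_
    rw [Finset.sum_add_distrib, Finset.sum_const, nsmul_eq_mul]
    apply le_of_eq; ring
  have hZW : V.card * W ≤ T.card := by
    rw [hZ, ← nsmul_eq_mul]
    exact Finset.card_nsmul_le_sum _ _ _ hVW
  set Z : ℝ := (T.card : ℝ)
  have hfin : Z ^ 2 ≤ (q * n) * (Z + ((V.card : ℝ) ^ 2 - V.card) * θ) := by
    refine hcs.trans ?_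
    rw [Finset.card_product]
    push_cast
    have h0 := (Nat.cast_nonneg (α := ℝ) _).trans (hcnt.trans hsum)
    gcongr
    exact hcnt.trans hsum
  have hq : q * n * θ = W ^ 2 / 2 := by rw [hθ]; field_simp
  have e : (q * n) * (Z + ((V.card : ℝ) ^ 2 - V.card) * θ)
      = q * n * Z + ((V.card : ℝ) ^ 2 - V.card) * (W ^ 2 / 2) := by rw [← hq]; ring
  rw [e] at hfin
  have h3 : (V.card * W) ^ 2 ≤ Z ^ 2 := by gcongr
  have hZ0 : 0 ≤ Z := by positivity
  have h4 : 2 * q * n * Z ≤ Z * Z := by gcongr; linarith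
  nlinarith [mul_pos hVpos (pow_pos hW 2)]
end


section
set_option linter.unusedSectionVars false
variable {F : Type*} [Field F] [Fintype F] [DecidableEq F]

def Uset (A B2 C : Finset F) (g l : F) : Finset ((F × F) × (F × F)) :=
  ((A ×ˢ B2) ×ˢ (C ×ˢ C)).filter fun z => z.2.2 - lev g z.1 = l * (z.2.1 - lev g z.1)

lemma transfer (A B C B2 : Finset F) (hA : ∀ a ∈ A, a ≠ 0) (hB : ∀ b ∈ B, b ≠ 0)
    (hB2 : ∀ b ∈ B2, b ≠ 0)
    (hC : ∀ s ∈ A, ∀ a ∈ A, s * (a + 1) ∈ C) (σ τ f : F) (hσ : σ ≠ 0) (t t' : F × F)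
    (ht : t ∈ A ×ˢ B) (ht' : t' ∈ A ×ˢ B) (hne : t ≠ t') (hlev : lev f t = lev f t') :
    ∃ l : F, l ≠ 1 ∧ A.card * (Tset A B2 (fun x => σ * x + τ) t t').card
      ≤ (Uset A B2 C (σ * f + τ) l).card := by
  obtain ⟨s1, b1⟩ := t
  obtain ⟨s2, b2⟩ := t'
  simp only [Finset.mem_product] at ht ht'
  have s1n := hA _ ht.1
  have s2n := hA _ ht'.1
  have b1n := hB _ ht.2
  have b2n := hB _ ht'.2
  refine ⟨(s1 * b2) / (s2 * b1), ?_, ?_⟩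
  · intro h
    rw [div_eq_one_iff_eq (mul_ne_zero s2n b1n)] at h
    unfold lev at hlev
    simp only at hlev
    field_simp at hlev
    have h5 : s1 = s2 := by
      have : b1 * b2 * (s1 - s2) = 0 := by linear_combination hlev - f * h
      have h6 := (mul_eq_zero.mp this).resolve_left (mul_ne_zero b1n b2n)
      exact sub_eq_zero.mp h6
    subst h5
    have := mul_left_cancel₀ s1n h
    exact hne (by rw [this])
  · rw [← Finset.card_product]
    refine Finset.card_le_card_of_injOn
      (fun z => ((z.1, z.2.2), (lev (σ * z.2.1.1 + τ) (z.1, z.2.2), lev (σ * z.2.1.2 + τ) (z.1, z.2.2)))) ?_ ?_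
    · rintro ⟨s, ⟨x, x'⟩, b⟩ hz
      simp [Tset] at hz
      obtain ⟨h1, h2, ⟨h3, h4⟩, ⟨h5, h6⟩, h7⟩ := hz
      have bn := hB2 _ h2
      simp only [Uset, Finset.coe_filter, Set.mem_ofPred_eq, Finset.mem_product]
      refine ⟨⟨⟨h1, h2⟩, hC _ h1 _ h4, hC _ h1 _ h6⟩, ?_⟩
      unfold lev at *
      simp only at *
      have key : (s2 * b1) * (x' - f) = (s1 * b2) * (x - f) := by
        field_simp at h7 hlev
        linear_combination hlev - h7
      field_simp
      linear_combination (s * σ) * key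
    · rintro ⟨s, ⟨x, x'⟩, b⟩ hz ⟨s', ⟨y, y'⟩, b'⟩ hz' hh
      simp [Tset] at hz hz' hh
      obtain ⟨⟨rfl, rfl⟩, h1, h2⟩ := hh
      have e1 := lev_inj (hA _ hz.1) (hB2 _ hz.2.1) h1
      have e2 := lev_inj (hA _ hz.1) (hB2 _ hz.2.1) h2
      have e1 := mul_left_cancel₀ hσ (add_right_cancel e1)
      have e2 := mul_left_cancel₀ hσ (add_right_cancel e2)
      simp [e1, e2]

lemma lev_det {l y y' v : F} (hl : l ≠ 1) (h : y' - v = l * (y - v)) : v = (y' - l * y) / (1 - l) := by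
  have : 1 - l ≠ 0 := sub_ne_zero.mpr hl.symm
  field_simp
  linear_combination -h

lemma U_le_max (A B2 C : Finset F) (g l : F) (hl : l ≠ 1) (M : ℝ)
    (hM : ∀ v, (((A ×ˢ B2).filter fun t => lev g t = v).card : ℝ) ≤ M) :
    ((Uset A B2 C g l).card : ℝ) ≤ (C.card : ℝ) ^ 2 * M := by
  rw [Finset.card_eq_sum_card_fiberwise (f := fun z => z.2) (t := C ×ˢ C)]
  · push_cast
    calc _ ≤ ∑ y ∈ C ×ˢ C, M := by
          refine Finset.sum_le_sum fun y hy => ?_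
          refine le_trans ?_ (hM ((y.2 - l * y.1) / (1 - l)))
          norm_cast
          refine Finset.card_le_card_of_injOn (fun z => z.1) ?_ ?_
          · rintro ⟨t, y'⟩ hz
            simp [Uset] at hz
            obtain ⟨⟨h1, h2⟩, rfl⟩ := hz
            simp
            exact ⟨h1.1, lev_det hl h2⟩
          · rintro ⟨t, y'⟩ hz ⟨t', y''⟩ hz' hh
            simp at hz hz' hh ⊢
            exact ⟨hh, hz.2.trans hz'.2.symm⟩
      _ = _ := by rw [Finset.sum_const, Finset.card_product, nsmul_eq_mul]; push_cast; ring
  · intro z hz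
    simp [Uset] at hz ⊢
    exact hz.1.2

lemma U_le_energy (A B2 C : Finset F) (g l : F) (hl : l ≠ 1) :
    ((Uset A B2 C g l).card : ℝ) ^ 2 ≤ (C.card : ℝ) ^ 3 *
      (((A ×ˢ B2) ×ˢ (A ×ˢ B2)).filter fun z => lev g z.1 = lev g z.2).card := by
  have h1 := cs_card (Uset A B2 C g l) (C ×ˢ C) (fun z => z.2) (by
    intro z hz
    simp [Uset] at hz ⊢
    exact hz.1.2)
  refine h1.trans ?_
  rw [Finset.card_product]
  push_cast
  have h2 : (((Uset A B2 C g l ×ˢ Uset A B2 C g l).filter fun z => z.1.2 = z.2.2).card)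
     ≤ C.card * (((A ×ˢ B2) ×ˢ (A ×ˢ B2)).filter fun z => lev g z.1 = lev g z.2).card := by
    rw [← Finset.card_product]
    refine Finset.card_le_card_of_injOn (fun z => (z.1.2.1, (z.1.1, z.2.1))) ?_ ?_
    · rintro ⟨⟨t, y⟩, ⟨t', y'⟩⟩ hz
      simp [Uset] at hz
      obtain ⟨⟨⟨h1, h2⟩, h3, h4⟩, rfl⟩ := hz
      have := (lev_det hl h2).trans (lev_det hl h4).symm
      simp [this]
      tauto
    · rintro ⟨⟨t, y⟩, ⟨t', y'⟩⟩ hz ⟨⟨u, w⟩, ⟨u', w'⟩⟩ hz' hh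
      simp [Uset] at hz hz' hh
      obtain ⟨⟨⟨h1, h2⟩, h3, h4⟩, rfl⟩ := hz
      obtain ⟨⟨⟨h1', h2'⟩, h3', h4'⟩, rfl⟩ := hz'
      obtain ⟨e, rfl, rfl⟩ := hh
      have : y.2 = w.2 := by
        rw [← e] at h2'
        exact sub_left_inj.mp (h2.trans h2'.symm)
      have : y = w := Prod.ext e this
      simp [this]
  have h2' : ((((Uset A B2 C g l ×ˢ Uset A B2 C g l).filter fun z => z.1.2 = z.2.2).card) : ℝ)
     ≤ C.card * (((A ×ˢ B2) ×ˢ (A ×ˢ B2)).filter fun z => lev g z.1 = lev g z.2).card := by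
    exact_mod_cast h2
  calc _ ≤ (C.card : ℝ) * C.card * (C.card * (((A ×ˢ B2) ×ˢ (A ×ˢ B2)).filter fun z => lev g z.1 = lev g z.2).card) := by gcongr
    _ = _ := by ring

/-- average energy -/
lemma avg_energy (A B : Finset F) (hB : ∀ b ∈ B, b ≠ 0) (hA : ∀ a ∈ A, a ≠ 0)
    (hp : A.card * B.card ≤ Fintype.card F) :
    ∃ f : F, (((A ×ˢ B) ×ˢ (A ×ˢ B)).filter fun z => lev f z.1 = lev f z.2).card
      ≤ 2 * (A.card * B.card) := by
  by_contra hcon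
  push Not at hcon
  have h1 : ∑ f : F, 2 * (A.card * B.card) <
      ∑ f : F, (((A ×ˢ B) ×ˢ (A ×ˢ B)).filter fun z => lev f z.1 = lev f z.2).card :=
    Finset.sum_lt_sum_of_nonempty Finset.univ_nonempty fun f _ => hcon f
  have h2 : ∑ f : F, (((A ×ˢ B) ×ˢ (A ×ˢ B)).filter fun z => lev f z.1 = lev f z.2).card
      = ∑ z ∈ (A ×ˢ B) ×ˢ (A ×ˢ B), (Finset.univ.filter fun f : F => lev f z.1 = lev f z.2).card := by
    simp only [Finset.card_filter]
    rw [Finset.sum_comm]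
  have h3 : ∀ z ∈ (A ×ˢ B) ×ˢ (A ×ˢ B), (Finset.univ.filter fun f : F => lev f z.1 = lev f z.2).card
      ≤ (if z.1 = z.2 then Fintype.card F else 0) + 1 := by
    rintro ⟨⟨s1, b1⟩, ⟨s2, b2⟩⟩ hz
    simp only [Finset.mem_product] at hz
    obtain ⟨⟨h1, h2⟩, h3, h4⟩ := hz
    split_ifs with h
    · exact (Finset.card_le_univ _).trans (Nat.le_succ _)
    · rw [zero_add, Finset.card_le_one]
      intro f hf g hg
      replace hf := (Finset.mem_filter.mp hf).2
      replace hg := (Finset.mem_filter.mp hg).2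
      simp only [lev] at hf hg
      have b1n := hB _ h2
      have b2n := hB _ h4
      by_contra hfg
      have hfg' : f - g ≠ 0 := sub_ne_zero.mpr hfg
      field_simp at hf hg
      have e1 : s1 * b2 = s2 * b1 := by
        have : (f - g) * (s1 * b2 - s2 * b1) = 0 := by linear_combination hf - hg
        exact sub_eq_zero.mp ((mul_eq_zero.mp this).resolve_left hfg')
      have e2 : s1 = s2 := by
        have : b1 * b2 * (s1 - s2) = 0 := by linear_combination hf - f * e1
        exact sub_eq_zero.mp ((mul_eq_zero.mp this).resolve_left (mul_ne_zero b1n b2n))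
      subst e2
      exact h (by rw [mul_left_cancel₀ (hA _ h1) e1])
  have h4 := Finset.sum_le_sum h3
  rw [Finset.sum_add_distrib] at h4
  have h5 : ∑ z ∈ (A ×ˢ B) ×ˢ (A ×ˢ B), (if z.1 = z.2 then Fintype.card F else 0)
      = (A.card * B.card) * Fintype.card F := by
    rw [Finset.sum_product]
    simp only [Finset.sum_ite_eq]
    rw [Finset.sum_congr rfl (g := fun _ => Fintype.card F)]
    · simp
    · intro x hx; simp only [hx, if_true]
  rw [h5] at h4
  simp only [Finset.sum_const, Finset.card_product, smul_eq_mul, mul_one, Finset.card_univ] at h4 h1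
  rw [h2] at h1
  have h6 := Nat.mul_le_mul_left (A.card * B.card) hp
  have h7 := h1.trans_le h4
  nlinarith [h6, h7]

end

lemma closed_univ {p : ℕ} [Fact p.Prime] (D : Finset (ZMod p)) (hD : D.Nonempty) (ρ σ τ : ZMod p)
    (hρ0 : ρ ≠ 0) (hρ : ρ ≠ 1) (hσ : σ ≠ 0) (hτ : τ ≠ 0) (h1 : ∀ f ∈ D, ρ * f ∈ D)
    (h2 : ∀ f ∈ D, σ * f + τ ∈ D) : ∀ f, f ∈ D := by
  have key : ∀ (g : ZMod p → ZMod p), Function.Injective g → (∀ f ∈ D, g f ∈ D) →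
      ∀ f ∈ D, ∃ e ∈ D, g e = f := by
    intro g hg hgD f hf
    have : D.image g = D := Finset.eq_of_subset_of_card_le
      (by intro x hx; simp at hx; obtain ⟨a, ha, rfl⟩ := hx; exact hgD a ha)
      (by rw [Finset.card_image_of_injective _ hg])
    rw [← this] at hf
    simpa using hf
  have htr : ∀ f ∈ D, f + (ρ - 1) * τ ∈ D := by
    intro f hf
    obtain ⟨e, he, hef⟩ := key (fun x => σ * x + τ) (fun x y h => by
      simpa [hσ] using h) h2 f hf
    obtain ⟨e', he', hef'⟩ := key (fun x => ρ * x) (fun x y h => by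
      simpa [hρ0] using h) h1 e he
    have := h1 _ (h2 _ he')
    convert this using 1
    rw [← hef, ← hef']
    ring
  have hu : (ρ - 1) * τ ≠ 0 := mul_ne_zero (sub_ne_zero.mpr hρ) hτ
  have hk : ∀ k : ℕ, ∀ f ∈ D, f + k * ((ρ - 1) * τ) ∈ D := by
    intro k
    induction k with
    | zero => intro f hf; simpa using hf
    | succ k ih =>
      intro f hf
      have := htr _ (ih f hf)
      convert this using 1
      push_cast; ring
  intro f
  obtain ⟨e, he⟩ := hD
  have := hk ((f - e) / ((ρ - 1) * τ)).val e he
  rw [ZMod.natCast_zmod_val] at this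
  convert this using 1
  field_simp
  ring


section
variable {F : Type*} [Field F] [Fintype F] [DecidableEq F]

/-- passage from a rich level set at `f` to many points at `σ f + τ` -/
lemma step_U (A B C B1 B2 : Finset F) (hA : ∀ a ∈ A, a ≠ 0) (hB : ∀ b ∈ B, b ≠ 0)
    (hC : ∀ s ∈ A, ∀ a ∈ A, s * (a + 1) ∈ C) (hB1 : B1 ⊆ B) (hB2 : B2 ⊆ B)
    (n q W : ℝ) (hn : 0 < n) (hnA : (A.card : ℝ) = n) (hnB : (B.card : ℝ) = n)
    (hq : (C.card : ℝ) = q) (hq0 : 0 < q) (hW : 0 < W) (σ τ f v : F) (hσ : σ ≠ 0)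
    (hP : ∀ b ∈ B1, W ≤ (Pset A B2 (fun x => σ * x + τ) b).card)
    (hv : 2 * q * n ≤ (((A ×ˢ B1).filter fun t => lev f t = v).card : ℝ) * W) :
    ∃ l : F, l ≠ 1 ∧ W ^ 2 / (2 * q) ≤ ((Uset A B2 C (σ * f + τ) l).card : ℝ) := by
  obtain ⟨t, ht, t', ht', hne, hT⟩ := good_pair A B C B2 hA hB hC n W hn
    (by rw [← hnB]; exact_mod_cast Finset.card_le_card hB2) hW (fun x => σ * x + τ)
    ((A ×ˢ B1).filter fun t => lev f t = v)
    ((Finset.filter_subset _ _).trans (Finset.product_subset_product_right hB1))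
    (by rw [hq]; exact hq0)
    (by
      intro t ht
      simp only [Finset.mem_filter, Finset.mem_product] at ht
      exact hP _ ht.1.2)
    (by rw [hq]; exact hv)
  simp only [Finset.mem_filter, Finset.mem_product] at ht ht'
  obtain ⟨l, hl, hU⟩ := transfer A B C B2 hA hB (fun b hb => hB b (hB2 hb)) hC σ τ f hσ t t'
    (Finset.mem_product.mpr ⟨ht.1.1, hB1 ht.1.2⟩) (Finset.mem_product.mpr ⟨ht'.1.1, hB1 ht'.1.2⟩) hne
    (ht.2.trans ht'.2.symm)
  refine ⟨l, hl, ?_⟩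
  have hU' : (A.card : ℝ) * (Tset A B2 (fun x => σ * x + τ) t t').card
      ≤ (Uset A B2 C (σ * f + τ) l).card := by exact_mod_cast hU
  refine le_trans ?_ hU'
  rw [hnA]
  rw [hq] at hT
  calc W ^ 2 / (2 * q) = n * (W ^ 2 / (2 * q * n)) := by field_simp
    _ ≤ _ := by gcongr

lemma step_D (A B C B1 : Finset F) (hA : ∀ a ∈ A, a ≠ 0) (hB : ∀ b ∈ B, b ≠ 0)
    (hC : ∀ s ∈ A, ∀ a ∈ A, s * (a + 1) ∈ C) (hB1 : B1 ⊆ B)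
    (n q W : ℝ) (hn : 0 < n) (hnA : (A.card : ℝ) = n) (hnB : (B.card : ℝ) = n)
    (hq : (C.card : ℝ) = q) (hq0 : 0 < q) (hW : 0 < W) (σ τ f v : F) (hσ : σ ≠ 0)
    (hW3 : 4 * q ^ 4 * n ≤ W ^ 3)
    (hP : ∀ b ∈ B1, W ≤ (Pset A B1 (fun x => σ * x + τ) b).card)
    (hv : 2 * q * n ≤ (((A ×ˢ B1).filter fun t => lev f t = v).card : ℝ) * W) :
    ∃ v', 2 * q * n ≤ (((A ×ˢ B1).filter fun t => lev (σ * f + τ) t = v').card : ℝ) * W := by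
  by_contra hcon
  push Not at hcon
  obtain ⟨l, hl, hU⟩ := step_U A B C B1 B1 hA hB hC hB1 hB1 n q W hn hnA hnB hq hq0 hW σ τ f v hσ hP hv
  have hne : (Finset.univ : Finset F).Nonempty := Finset.univ_nonempty
  obtain ⟨v0, -, hv0⟩ := Finset.exists_max_image Finset.univ
    (fun v => (((A ×ˢ B1).filter fun t => lev (σ * f + τ) t = v).card : ℝ)) hne
  have h1 := U_le_max A B1 C (σ * f + τ) l hl _ (fun v => hv0 v (Finset.mem_univ v))
  have h2 := hcon v0
  rw [hq] at h1
  have h3 := hU.trans h1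
  set m : ℝ := (((A ×ˢ B1).filter fun t => lev (σ * f + τ) t = v0).card : ℝ)
  rw [div_le_iff₀ (by positivity)] at h3
  have h4 : W ^ 2 * W ≤ q ^ 2 * m * (2 * q) * W := by gcongr
  have h5 : q ^ 3 * (m * W) < q ^ 3 * (2 * q * n) := by gcongr
  nlinarith
end

lemma main_arg {p : ℕ} [Fact p.Prime] (A B C B1 : Finset (ZMod p)) (hA : ∀ a ∈ A, a ≠ 0)
    (hB : ∀ b ∈ B, b ≠ 0)
    (hC : ∀ s ∈ A, ∀ a ∈ A, s * (a + 1) ∈ C) (hB1 : B1 ⊆ B) (hne : B1.Nonempty)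
    (n q W W0 : ℝ) (hn : 0 < n) (hnA : (A.card : ℝ) = n) (hnB : (B.card : ℝ) = n)
    (hq : (C.card : ℝ) = q) (hqn : n ≤ q) (hnp : n ^ 2 ≤ p) (hW : 0 < W) (hWW0 : W ≤ W0)
    (σ τ ρ : ZMod p)
    (hσ : σ ≠ 0) (hτ : τ ≠ 0) (hρ : ρ ≠ 0) (hρ1 : ρ ≠ 1)
    (hW3 : 4 * q ^ 4 * n ≤ W ^ 3)
    (hP1 : ∀ b ∈ B1, W ≤ (Pset A B1 (fun x => σ * x + τ) b).card)
    (hP2 : ∀ b ∈ B1, W ≤ (Pset A B1 (fun x => ρ * x) b).card)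
    (hP0 : ∀ b ∈ B1, W0 ≤ (Pset A B (fun x => x) b).card) :
    W0 ^ 4 ≤ 8 * q ^ 5 * n ^ 2 := by
  classical
  have hq0 : 0 < q := hn.trans_le hqn
  let D : Finset (ZMod p) := Finset.univ.filter fun f =>
    ∃ v, 2 * q * n ≤ (((A ×ˢ B1).filter fun t => lev f t = v).card : ℝ) * W
  have hWB : W ≤ n * B1.card := by
    obtain ⟨b, hb⟩ := hne
    refine (hP2 b hb).trans ?_
    rw [← hnA]
    norm_cast
    rw [← Finset.card_product]
    have bn := hB _ (hB1 hb)
    refine Finset.card_le_card_of_injOn (fun z => (z.1 / b, z.2)) ?_ ?_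
    · rintro ⟨x, c⟩ hz
      simp [Pset] at hz ⊢
      tauto
    · rintro ⟨x, c⟩ hz ⟨y, d⟩ hz' hh
      simp at hh ⊢
      field_simp at hh
      exact hh
  have hBn : (B1.card : ℝ) ≤ n := by rw [← hnB]; exact_mod_cast Finset.card_le_card hB1
  have h0 : (0 : ZMod p) ∈ D := by
    have hAne : A.Nonempty := by
      rw [← Finset.card_pos]; rw [← hnA] at hn; exact_mod_cast hn
    obtain ⟨s, hs⟩ := hAne
    simp only [D, Finset.mem_filter, Finset.mem_univ, true_and]
    refine ⟨s, ?_⟩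
    have hle : (B1.card : ℝ) ≤ (((A ×ˢ B1).filter fun t => lev 0 t = s).card : ℝ) := by
      norm_cast
      refine Finset.card_le_card_of_injOn (fun b => (s, b)) ?_ ?_
      · intro b hb
        simp at hb
        simp [hs, hb, lev]
      · intro b _ b' _ h
        simpa using h
    refine le_trans ?_ (mul_le_mul_of_nonneg_right hle hW.le)
    have hWn : W ≤ n ^ 2 := hWB.trans (by nlinarith)
    have hW2 : 2 * q * n ^ 2 ≤ W ^ 2 := by
      have h1 : W ^ 3 ≤ n ^ 2 * W ^ 2 := by nlinarith [pow_pos hW 2]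
      have h2 : n ^ 3 ≤ q ^ 3 := by gcongr
      have h3 : n ^ 2 * (2 * q * n ^ 2) ≤ n ^ 2 * W ^ 2 := by
        refine le_trans ?_ (hW3.trans h1)
        have : 2 * (q * n) * n ^ 3 ≤ 2 * (q * n) * q ^ 3 := by gcongr
        have h6 : 0 < q ^ 4 * n := by positivity
        nlinarith
      exact le_of_mul_le_mul_left h3 (by positivity)
    have h4 : n * (2 * q * n) ≤ n * (B1.card * W) := by nlinarith
    exact le_of_mul_le_mul_left h4 hn
  have hall := closed_univ D ⟨0, h0⟩ ρ σ τ hρ hρ1 hσ hτ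
    (by
      intro f hf
      simp only [D, Finset.mem_filter, Finset.mem_univ, true_and] at hf ⊢
      obtain ⟨v, hv⟩ := hf
      have := step_D A B C B1 hA hB hC hB1 n q W hn hnA hnB hq hq0 hW ρ 0 f v hρ hW3
        (by simpa using hP2) hv
      simpa using this)
    (by
      intro f hf
      simp only [D, Finset.mem_filter, Finset.mem_univ, true_and] at hf ⊢
      obtain ⟨v, hv⟩ := hf
      exact step_D A B C B1 hA hB hC hB1 n q W hn hnA hnB hq hq0 hW σ τ f v hσ hW3 hP1 hv)
  obtain ⟨f, hf⟩ := avg_energy A B hB hA (by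
    rw [ZMod.card]
    have : (A.card : ℝ) * B.card ≤ p := by rw [hnA, hnB]; nlinarith
    exact_mod_cast this)
  have hfD := hall f
  simp only [D, Finset.mem_filter, Finset.mem_univ, true_and] at hfD
  obtain ⟨v, hv⟩ := hfD
  have hW00 : 0 < W0 := hW.trans_le hWW0
  obtain ⟨l, hl, hU⟩ := step_U A B C B1 B hA hB hC hB1 (Finset.Subset.refl B) n q W0 hn hnA hnB hq hq0 hW00
    1 0 f v one_ne_zero (by simpa using hP0) (hv.trans (by gcongr))
  simp only [one_mul, add_zero] at hU
  have hE := U_le_energy A B C f l hl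
  have hf' : ((((A ×ˢ B) ×ˢ (A ×ˢ B)).filter fun z => lev f z.1 = lev f z.2).card : ℝ)
      ≤ 2 * n ^ 2 := by
    have : ((((A ×ˢ B) ×ˢ (A ×ˢ B)).filter fun z => lev f z.1 = lev f z.2).card : ℝ)
      ≤ 2 * (A.card * B.card) := by exact_mod_cast hf
    rw [hnA, hnB] at this
    linarith
  rw [hq] at hE
  have h1 : (W0 ^ 2 / (2 * q)) ^ 2 ≤ q ^ 3 * (2 * n ^ 2) := by
    calc _ ≤ ((Uset A B C f l).card : ℝ) ^ 2 := by gcongr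
      _ ≤ _ := hE
      _ ≤ _ := by gcongr
  rw [div_pow, div_le_iff₀ (by positivity)] at h1
  nlinarith


lemma prune {ι : Type*} [DecidableEq ι] (B' : Finset ι) (P : ι → ι → ℝ) (hP0 : ∀ i j, 0 ≤ P i j)
    (hsymm : ∀ i j, P i j = P j i) (W : ℝ)
    (hQ : 2 * W * B'.card < ∑ b ∈ B', ∑ b' ∈ B', P b b') :
    ∃ B1 ⊆ B', B1.Nonempty ∧ ∀ b ∈ B1, W ≤ ∑ b' ∈ B1, P b b' := by
  obtain ⟨U, hU, hmax⟩ := Finset.exists_max_image B'.powerset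
    (fun U => (∑ b ∈ U, ∑ b' ∈ U, P b b') - 2 * W * U.card) ⟨B', by simp⟩
  rw [Finset.mem_powerset] at hU
  have hB := hmax B' (by simp)
  refine ⟨U, hU, ?_, ?_⟩
  · rw [Finset.nonempty_iff_ne_empty]
    rintro rfl
    simp at hB
    linarith
  · intro b hb
    have h1 := hmax (U.erase b) (by
      rw [Finset.mem_powerset]; exact (Finset.erase_subset _ _).trans hU)
    have hc : ((U.erase b).card : ℝ) = U.card - 1 := by
      rw [Finset.card_erase_of_mem hb, Nat.cast_sub (Finset.card_pos.mpr ⟨b, hb⟩)]; simp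
    have h2 : ∑ x ∈ U, ∑ y ∈ U, P x y = ∑ y ∈ U, P b y + ∑ x ∈ U.erase b, ∑ y ∈ U, P x y := by
      rw [← Finset.add_sum_erase _ _ hb]
    have h3 : ∑ x ∈ U.erase b, ∑ y ∈ U, P x y
        = ∑ x ∈ U.erase b, P b x + ∑ x ∈ U.erase b, ∑ y ∈ U.erase b, P x y := by
      rw [← Finset.sum_add_distrib]
      refine Finset.sum_congr rfl fun x _ => ?_
      rw [← Finset.add_sum_erase _ _ hb, hsymm x b]
    have h4 : ∑ y ∈ U, P b y = P b b + ∑ x ∈ U.erase b, P b x := by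
      rw [← Finset.add_sum_erase _ _ hb]
    rw [h2, h3, hc] at h1
    have := hP0 b b
    linarith

lemma trim {α ι κ : Type*} [DecidableEq α] [DecidableEq ι] [DecidableEq κ] (Y : Finset α) (S : Finset ι) (φ : ι → α → κ) (C : Finset κ)
    (hφ : ∀ s ∈ S, ∀ y ∈ Y, φ s y ∈ C) (n q : ℝ) (hS : (S.card : ℝ) = n) (hq : (C.card : ℝ) = q)
    (hn : 0 < n) (hq0 : 0 < q) :
    ∃ Y' ⊆ Y, (Y.card : ℝ) / 2 ≤ Y'.card ∧ ∀ y ∈ Y', n ^ 2 * Y.card / (8 * q) ≤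
      (((S ×ˢ S) ×ˢ Y).filter fun z => φ z.1.1 y = φ z.1.2 z.2).card := by
  let u : κ → Finset (ι × α) := fun c => (S ×ˢ Y).filter fun z => φ z.1 z.2 = c
  let th : ℝ := n * Y.card / (4 * q)
  have hth : 0 ≤ th := by positivity
  let good : α → Finset ι := fun y => S.filter fun s => th ≤ (u (φ s y)).card
  let bad : α → Finset ι := fun y => S.filter fun s => ¬ th ≤ (u (φ s y)).card
  have hgb : ∀ y, ((good y).card : ℝ) + (bad y).card = n := by
    intro y
    rw [← hS]
    norm_cast
    exact Finset.card_filter_add_card_filter_not _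
  refine ⟨Y.filter fun y => n / 2 ≤ (good y).card, Finset.filter_subset _ _, ?_, ?_⟩
  · have hbad : ∑ y ∈ Y, ((bad y).card : ℝ) ≤ q * th := by
      have e : ∑ y ∈ Y, ((bad y).card : ℝ) =
          (((S ×ˢ Y).filter fun z => ¬ th ≤ (u (φ z.1 z.2)).card).card : ℝ) := by
        rw [Finset.card_filter]
        push_cast
        rw [Finset.sum_product_right]
        refine Finset.sum_congr rfl fun y _ => ?_
        simp only [bad, Finset.card_filter]
        push_cast
        rfl
      rw [e, Finset.card_eq_sum_card_fiberwise (f := fun z => φ z.1 z.2) (t := C)]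
      · push_cast
        calc _ ≤ ∑ c ∈ C, th := by
              refine Finset.sum_le_sum fun c _ => ?_
              by_cases hc : th ≤ (u c).card
              · refine le_trans (le_of_eq ?_) hth
                rw [Nat.cast_eq_zero, Finset.card_eq_zero, Finset.filter_eq_empty_iff]
                intro z hz h
                rw [Finset.mem_filter] at hz
                rw [h] at hz
                exact hz.2 hc
              · refine le_trans ?_ (not_le.mp hc).le
                norm_cast
                refine Finset.card_le_card fun z hz => ?_
                simp only [Finset.mem_filter] at hz
                simp only [u, Finset.mem_filter]
                exact ⟨hz.1.1, hz.2⟩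
          _ = _ := by rw [Finset.sum_const, nsmul_eq_mul, hq]
      · intro z hz
        simp only [Finset.coe_filter, Finset.mem_product, Set.mem_ofPred_eq] at hz
        exact hφ _ hz.1.1 _ hz.1.2
    have h2 : ((Y.filter fun y => ¬ n / 2 ≤ (good y).card).card : ℝ) * (n / 2) ≤ q * th := by
      refine le_trans ?_ hbad
      rw [← nsmul_eq_mul]
      refine le_trans ?_ (Finset.sum_le_sum_of_subset_of_nonneg (Finset.filter_subset (fun y => ¬ n / 2 ≤ (good y).card) Y) (fun _ _ _ => Nat.cast_nonneg _))
      refine Finset.card_nsmul_le_sum _ _ _ fun y hy => ?_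
      rw [Finset.mem_filter] at hy
      have := hgb y
      have := not_le.mp hy.2
      linarith
    have h3 : ((Y.filter fun y => n / 2 ≤ (good y).card).card : ℝ) +
        (Y.filter fun y => ¬ n / 2 ≤ (good y).card).card = Y.card := by
      norm_cast
      exact Finset.card_filter_add_card_filter_not _
    have h4 : q * th = (Y.card / 2) * (n / 2) := by
      simp only [th]; field_simp; norm_num
    rw [h4] at h2
    have := le_of_mul_le_mul_right h2 (by positivity)
    linarith
  · intro y hy
    rw [Finset.mem_filter] at hy
    have e : ((((S ×ˢ S) ×ˢ Y).filter fun z => φ z.1.1 y = φ z.1.2 z.2).card : ℝ)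
        = ∑ s ∈ S, ((u (φ s y)).card : ℝ) := by
      rw [Finset.card_filter]
      push_cast
      rw [Finset.sum_product, Finset.sum_product]
      refine Finset.sum_congr rfl fun s _ => ?_
      simp only [u, Finset.card_filter]
      push_cast
      rw [Finset.sum_product]
      refine Finset.sum_congr rfl fun s' _ => Finset.sum_congr rfl fun y' _ => ?_
      simp only [eq_comm]
    rw [e]
    calc n ^ 2 * Y.card / (8 * q) = (n / 2) * th := by simp only [th]; field_simp; ring
      _ ≤ (good y).card * th := by gcongr; exact hy.2
      _ ≤ ∑ s ∈ good y, ((u (φ s y)).card : ℝ) := by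
        rw [← nsmul_eq_mul]
        refine Finset.card_nsmul_le_sum _ _ _ fun s hs => ?_
        exact (Finset.mem_filter.mp hs).2
      _ ≤ _ := Finset.sum_le_sum_of_subset_of_nonneg (Finset.filter_subset _ _)
          (fun _ _ _ => Nat.cast_nonneg _)

lemma card_offDiag_bound {α : Type*} [DecidableEq α] (B : Finset α) (p : α × α → Prop) [DecidablePred p] :
    (((B ×ˢ B).filter p).card : ℝ) ≤ (B.offDiag.filter p).card + B.card := by
  rw [← Finset.diag_union_offDiag, Finset.filter_union]
  norm_cast
  refine (Finset.card_union_le _ _).trans ?_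
  have : (B.diag.filter p).card ≤ B.card := (Finset.card_filter_le _ _).trans (by simp)
  omega


section
variable {F : Type*} [Field F] [Fintype F] [DecidableEq F]

def Rset (A : Finset F) (b b' : F) : Finset F := Finset.univ.filter fun x => x / b ∈ A ∧ x / b' ∈ A

def mp1 (b0 : F) (s : F × F) (x : F) : F := s.1 / s.2 * x + (s.1 / s.2 - 1) * b0

def mp2 (s : F × F) (x : F) : F := s.1 / s.2 * x

lemma choice_pair (A B C : Finset F) (hA : ∀ a ∈ A, a ≠ 0) (hB : ∀ b ∈ B, b ≠ 0)
    (hC : ∀ s ∈ A, ∀ a ∈ A, s * (a + 1) ∈ C) (hCB : ∀ a ∈ A, ∀ b ∈ B, b * a ∈ C)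
    (n q : ℝ) (hn : 0 < n) (hnA : (A.card : ℝ) = n) (hnB : (B.card : ℝ) = n)
    (hq : (C.card : ℝ) = q) (hq0 : 0 < q) (b b' : F) (hb : b ∈ B)
    (Y : Finset F) (hYR : Y ⊆ Rset A b b')
    (hY : ∀ y ∈ Y, n ^ 2 / (2 * q) ≤ (B.filter fun β => y / β ∈ A).card) :
    n ^ 7 * (Y.card : ℝ) ^ 3 / (2 ^ 11 * q ^ 4) - 2 * n ^ 5 ≤
      ∑ b0 ∈ B, ∑ x ∈ Rset A b b',
        ((A.offDiag.filter fun s => mp1 b0 s x ∈ Rset A b b').card : ℝ) *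
        (B.offDiag.filter fun s => mp2 s x ∈ Rset A b b').card := by
  obtain ⟨Y', hY', hYc, hG⟩ := trim Y B (fun β y => β * (y / b)) C (by
    intro β hβ y hy
    have := hYR hy
    simp only [Rset, Finset.mem_filter, Finset.mem_univ, true_and] at this
    exact hCB _ this.1 _ hβ) n q hnB hq hn hq0
  have hG' : ∀ y ∈ Y', n ^ 2 * Y.card / (8 * q) ≤
      ((B ×ˢ B).filter fun s => mp2 s y ∈ Rset A b b').card := by
    intro y hy
    refine (hG y hy).trans ?_
    norm_cast
    refine Finset.card_le_card_of_injOn (fun z => z.1) ?_ ?_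
    · rintro ⟨⟨β, β'⟩, y''⟩ hz
      simp only [Finset.coe_filter, Finset.mem_product, Set.mem_ofPred_eq] at hz ⊢
      obtain ⟨⟨⟨h1, h2⟩, h3⟩, h4⟩ := hz
      have := hB _ hb
      have := hB _ h2
      refine ⟨⟨h1, h2⟩, ?_⟩
      have e : mp2 (β, β') y = y'' := by
        simp only [mp2]
        field_simp at h4 ⊢
        linear_combination h4
      rw [e]; exact hYR h3
    · rintro ⟨⟨β, β'⟩, y1⟩ hz ⟨⟨γ, γ'⟩, y2⟩ hz' hh
      simp only [Finset.coe_filter, Finset.mem_product, Set.mem_ofPred_eq] at hz hz' hh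
      simp only [Prod.mk.injEq] at hh ⊢
      obtain ⟨rfl, rfl⟩ := hh
      refine ⟨⟨rfl, rfl⟩, ?_⟩
      have h5 := hz.2.symm.trans hz'.2
      have := hB _ hb
      have := hB _ hz.1.1.2
      field_simp at h5
      exact h5
  let X : F → Finset F := fun b0 => Y'.filter fun x => x / b0 ∈ A
  have hX : ∀ b0 ∈ B, ∃ X' ⊆ X b0, ((X b0).card : ℝ) / 2 ≤ X'.card ∧ ∀ x ∈ X',
      n ^ 2 * (X b0).card / (8 * q) ≤ ((A ×ˢ A).filter fun s => mp1 b0 s x ∈ Rset A b b').card := by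
    intro b0 hb0
    have bn := hB _ hb0
    obtain ⟨X', h1, h2, h3⟩ := trim (X b0) A (fun s x => s * (x / b0 + 1)) C (by
      intro s hs x hx
      exact hC _ hs _ (Finset.mem_filter.mp hx).2) n q hnA hq hn hq0
    refine ⟨X', h1, h2, fun x hx => (h3 x hx).trans ?_⟩
    norm_cast
    refine Finset.card_le_card_of_injOn (fun z => z.1) ?_ ?_
    · rintro ⟨⟨β, β'⟩, y''⟩ hz
      simp only [Finset.coe_filter, Finset.mem_product, Set.mem_ofPred_eq] at hz ⊢
      obtain ⟨⟨⟨h1, h2⟩, h3⟩, h4⟩ := hz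
      have := hA _ h2
      refine ⟨⟨h1, h2⟩, ?_⟩
      have e : mp1 b0 (β, β') x = y'' := by
        simp only [mp1]
        field_simp at h4 ⊢
        linear_combination h4
      rw [e]; exact hYR (hY' (Finset.mem_filter.mp h3).1)
    · rintro ⟨⟨β, β'⟩, y1⟩ hz ⟨⟨γ, γ'⟩, y2⟩ hz' hh
      simp only [Finset.coe_filter, Finset.mem_product, Set.mem_ofPred_eq] at hz hz' hh
      simp only [Prod.mk.injEq] at hh ⊢
      obtain ⟨rfl, rfl⟩ := hh
      refine ⟨⟨rfl, rfl⟩, ?_⟩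
      have h5 := hz.2.symm.trans hz'.2
      have := hA _ hz.1.1.2
      have h5 := add_right_cancel (mul_left_cancel₀ this h5)
      field_simp at h5
      exact h5
  have hRn : ((Rset A b b').card : ℝ) ≤ n := by
    rw [← hnA]
    norm_cast
    refine Finset.card_le_card_of_injOn (fun x => x / b) ?_ ?_
    · intro x hx
      simp [Rset] at hx
      exact hx.1
    · intro x _ y _ h
      have := hB _ hb
      simp only at h
      field_simp at h
      exact h
  -- pointwise in b0
  have hb0 : ∀ b0 ∈ B, (n ^ 4 * Y.card / (128 * q ^ 2)) * ((X b0).card : ℝ) ^ 2 - 2 * n ^ 4 ≤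
      ∑ x ∈ Rset A b b',
        ((A.offDiag.filter fun s => mp1 b0 s x ∈ Rset A b b').card : ℝ) *
        (B.offDiag.filter fun s => mp2 s x ∈ Rset A b b').card := by
    intro b0 hb0
    obtain ⟨X', h1, h2, h3⟩ := hX b0 hb0
    have hX'R : X' ⊆ Rset A b b' := h1.trans ((Finset.filter_subset _ _).trans (hY'.trans hYR))
    refine le_trans ?_ (Finset.sum_le_sum_of_subset_of_nonneg hX'R (fun _ _ _ => by positivity))
    have hX'n : (X'.card : ℝ) ≤ n := le_trans (by exact_mod_cast Finset.card_le_card hX'R) hRn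
    set V : ℝ := n ^ 2 * (X b0).card / (8 * q) * (n ^ 2 * Y.card / (8 * q)) with hV
    have hV0 : 0 ≤ V := by positivity
    have hpt : ∀ x ∈ X', V - 2 * n ^ 3 ≤
        ((A.offDiag.filter fun s => mp1 b0 s x ∈ Rset A b b').card : ℝ) *
        (B.offDiag.filter fun s => mp2 s x ∈ Rset A b b').card := by
      intro x hx
      have f1 := h3 x hx
      have f2 := hG' x (Finset.mem_filter.mp (h1 hx)).1
      have f3 := card_offDiag_bound A (fun s => mp1 b0 s x ∈ Rset A b b')
      have f4 := card_offDiag_bound B (fun s => mp2 s x ∈ Rset A b b')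
      have f5 : (((B ×ˢ B).filter fun s => mp2 s x ∈ Rset A b b').card : ℝ) ≤ n ^ 2 := by
        rw [sq]; nth_rewrite 1 [← hnB]; rw [← hnB]
        norm_cast
        rw [← Finset.card_product]
        exact Finset.card_filter_le _ _
      have f6 : ((A.offDiag.filter fun s => mp1 b0 s x ∈ Rset A b b').card : ℝ) ≤ n ^ 2 := by
        rw [sq]; nth_rewrite 1 [← hnA]; rw [← hnA]
        norm_cast
        rw [← Finset.card_product]
        refine (Finset.card_filter_le _ _).trans (Finset.card_le_card ?_)
        rw [← Finset.diag_union_offDiag]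
        exact Finset.subset_union_right
      rw [hnA] at f3
      rw [hnB] at f4
      set f : ℝ := (((A ×ˢ A).filter fun s => mp1 b0 s x ∈ Rset A b b').card : ℝ)
      set g : ℝ := (((B ×ˢ B).filter fun s => mp2 s x ∈ Rset A b b').card : ℝ)
      set f' : ℝ := ((A.offDiag.filter fun s => mp1 b0 s x ∈ Rset A b b').card : ℝ)
      set g' : ℝ := ((B.offDiag.filter fun s => mp2 s x ∈ Rset A b b').card : ℝ)
      have f0 : 0 ≤ f' := by positivity
      have g0 : 0 ≤ g := by positivity
      have hVfg : V ≤ f * g := by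
        rw [hV]; gcongr
      have k1 : f * g ≤ (f' + n) * g := by gcongr
      have k2 : f' * g ≤ f' * (g' + n) := by gcongr
      have k3 : n * g ≤ n * n ^ 2 := by gcongr
      have k4 : f' * n ≤ n ^ 2 * n := by gcongr
      nlinarith
    have hs := Finset.card_nsmul_le_sum _ _ _ hpt
    refine le_trans ?_ hs
    rw [nsmul_eq_mul]
    have k5 : ((X b0).card : ℝ) / 2 * V ≤ X'.card * V := by gcongr
    have k6 : (X'.card : ℝ) * (2 * n ^ 3) ≤ n * (2 * n ^ 3) := by gcongr
    have k7 : ((X b0).card : ℝ) / 2 * V = (n ^ 4 * Y.card / (128 * q ^ 2)) * ((X b0).card : ℝ) ^ 2 := by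
      rw [hV]; field_simp; ring
    nlinarith
  have hsum := Finset.sum_le_sum hb0
  refine le_trans ?_ hsum
  rw [Finset.sum_sub_distrib, ← Finset.mul_sum, Finset.sum_const, nsmul_eq_mul, hnB]
  have hXs : (Y.card : ℝ) * n ^ 2 / (4 * q) ≤ ∑ b0 ∈ B, ((X b0).card : ℝ) := by
    have e : ∑ b0 ∈ B, ((X b0).card : ℝ) = ∑ y ∈ Y', ((B.filter fun β => y / β ∈ A).card : ℝ) := by
      simp only [X, Finset.card_filter]
      push_cast
      rw [Finset.sum_comm]
    rw [e]
    calc _ = ((Y.card : ℝ) / 2) * (n ^ 2 / (2 * q)) := by field_simp; ring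
      _ ≤ Y'.card * (n ^ 2 / (2 * q)) := by gcongr
      _ ≤ _ := by
        rw [← nsmul_eq_mul]
        exact Finset.card_nsmul_le_sum _ _ _ fun y hy => hY y (hY' hy)
  have hcs := sq_sum_le_card_mul_sum_sq (s := B) (f := fun b0 => ((X b0).card : ℝ))
  rw [hnB] at hcs
  have h1 : ((Y.card : ℝ) * n ^ 2 / (4 * q)) ^ 2 ≤ n * ∑ b0 ∈ B, ((X b0).card : ℝ) ^ 2 := by
    refine le_trans ?_ hcs
    gcongr
  have h2 : (Y.card : ℝ) ^ 2 * n ^ 3 / (16 * q ^ 2) ≤ ∑ b0 ∈ B, ((X b0).card : ℝ) ^ 2 := by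
    refine le_of_mul_le_mul_left ?_ hn
    refine le_trans (le_of_eq ?_) h1
    field_simp; ring
  have h3 : (n ^ 4 * Y.card / (128 * q ^ 2)) * ((Y.card : ℝ) ^ 2 * n ^ 3 / (16 * q ^ 2)) ≤
    (n ^ 4 * Y.card / (128 * q ^ 2)) * ∑ b0 ∈ B, ((X b0).card : ℝ) ^ 2 := by gcongr
  have h4 : n ^ 7 * (Y.card : ℝ) ^ 3 / (2 ^ 11 * q ^ 4) =
    (n ^ 4 * Y.card / (128 * q ^ 2)) * ((Y.card : ℝ) ^ 2 * n ^ 3 / (16 * q ^ 2)) := by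
    field_simp; ring
  rw [h4]
  nlinarith
end


section
variable {F : Type*} [Field F] [Fintype F] [DecidableEq F]

lemma choice (A B C : Finset F) (hA : ∀ a ∈ A, a ≠ 0) (hB : ∀ b ∈ B, b ≠ 0)
    (hC : ∀ s ∈ A, ∀ a ∈ A, s * (a + 1) ∈ C) (hCB : ∀ a ∈ A, ∀ b ∈ B, b * a ∈ C)
    (n q : ℝ) (hn : 0 < n) (hnA : (A.card : ℝ) = n) (hnB : (B.card : ℝ) = n)
    (hq : (C.card : ℝ) = q) (hq0 : 0 < q) (hbig : 2 ^ 25 * q ^ 7 ≤ n ^ 8) :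
    ∃ B' ⊆ B, (∀ b ∈ B', n ^ 3 / (8 * q) ≤ (Pset A B (fun x => x) b).card) ∧
      ∃ b0 ∈ B, ∃ s ∈ A.offDiag, ∃ β ∈ B.offDiag,
        n ^ 10 / (2 ^ 24 * q ^ 7) ≤ ∑ b ∈ B', ∑ b' ∈ B',
          (((Rset A b b').filter fun x => mp1 b0 s x ∈ Rset A b b' ∧ mp2 β x ∈ Rset A b b').card : ℝ) := by
  let r : F → ℝ := fun c => ((B.filter fun β => c / β ∈ A).card : ℝ)
  let Cs : Finset F := C.filter fun c => n ^ 2 / (2 * q) ≤ r c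
  let w : F → Finset F := fun b => Cs.filter fun x => x / b ∈ A
  let B' : Finset F := B.filter fun b => n / 4 ≤ ((w b).card : ℝ)
  have hfull : ∀ b ∈ B, (C.filter fun x => x / b ∈ A).card = A.card := by
    intro b hb
    have bn := hB b hb
    refine Finset.card_bij (fun x _ => x / b) ?_ ?_ ?_
    · intro x hx; exact (Finset.mem_filter.mp hx).2
    · intro x _ y _ h
      field_simp at h; exact h
    · intro a ha
      refine ⟨b * a, ?_, ?_⟩
      · rw [Finset.mem_filter]
        refine ⟨hCB a ha b hb, ?_⟩
        rwa [mul_div_cancel_left₀ _ bn]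
      · rw [mul_div_cancel_left₀ _ bn]
  have hwn : ∀ b ∈ B, ((w b).card : ℝ) ≤ n := by
    intro b hb
    rw [← hnA, ← hfull b hb]
    norm_cast
    exact Finset.card_le_card (Finset.filter_subset_filter _ (Finset.filter_subset _ _))
  have hswap : ∀ (S T : Finset F), ∑ c ∈ S, ((T.filter fun β => c / β ∈ A).card : ℝ)
      = ∑ b ∈ T, ((S.filter fun x => x / b ∈ A).card : ℝ) := by
    intro S T
    simp only [Finset.card_filter]
    push_cast
    rw [Finset.sum_comm]
  have htot : ∑ c ∈ C, r c = n ^ 2 := by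
    rw [hswap C B, Finset.sum_congr rfl (g := fun _ => n)]
    · rw [Finset.sum_const, nsmul_eq_mul, hnB]; ring
    · intro b hb; rw [hfull b hb, hnA]
  have hCs : n ^ 2 / 2 ≤ ∑ c ∈ Cs, r c := by
    have h1 := Finset.sum_filter_add_sum_filter_not C (fun c => n ^ 2 / (2 * q) ≤ r c) r
    have h2 : ∑ c ∈ C.filter (fun c => ¬ n ^ 2 / (2 * q) ≤ r c), r c ≤ n ^ 2 / 2 := by
      calc _ ≤ ((C.filter (fun c => ¬ n ^ 2 / (2 * q) ≤ r c)).card : ℝ) * (n ^ 2 / (2 * q)) := by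
            rw [← nsmul_eq_mul]
            exact Finset.sum_le_card_nsmul _ _ _ fun c hc => (not_le.mp (Finset.mem_filter.mp hc).2).le
        _ ≤ q * (n ^ 2 / (2 * q)) := by
            gcongr
            rw [← hq]
            exact_mod_cast Finset.card_filter_le _ _
        _ = _ := by field_simp
    simp only [Cs]
    linarith
  have hB'sum : n ^ 2 / 4 ≤ ∑ b ∈ B', ((w b).card : ℝ) := by
    rw [hswap Cs B] at hCs
    have h1 := Finset.sum_filter_add_sum_filter_not B (fun b => n / 4 ≤ ((w b).card : ℝ))
      (fun b => ((w b).card : ℝ))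
    have h2 : ∑ b ∈ B.filter (fun b => ¬ n / 4 ≤ ((w b).card : ℝ)), ((w b).card : ℝ) ≤ n ^ 2 / 4 := by
      calc _ ≤ ((B.filter (fun b => ¬ n / 4 ≤ ((w b).card : ℝ))).card : ℝ) * (n / 4) := by
            rw [← nsmul_eq_mul]
            exact Finset.sum_le_card_nsmul _ _ _ fun c hc => (not_le.mp (Finset.mem_filter.mp hc).2).le
        _ ≤ n * (n / 4) := by
            gcongr
            rw [← hnB]
            exact_mod_cast Finset.card_filter_le _ _
        _ = _ := by ring
    simp only [B']
    have h3 : n ^ 2 / 2 ≤ ∑ b ∈ B, ((w b).card : ℝ) := hCs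
    linarith
  have hB'n : (B'.card : ℝ) ≤ n := by
    rw [← hnB]; exact_mod_cast Finset.card_filter_le _ _
  let Y : F → F → Finset F := fun b b' => Cs.filter fun x => x / b ∈ A ∧ x / b' ∈ A
  have hYsum : n ^ 4 / (16 * q) ≤ ∑ z ∈ B' ×ˢ B', ((Y z.1 z.2).card : ℝ) := by
    have e : ∑ z ∈ B' ×ˢ B', ((Y z.1 z.2).card : ℝ)
        = ∑ c ∈ Cs, ((B'.filter fun β => c / β ∈ A).card : ℝ) ^ 2 := by
      simp only [Y, Finset.card_filter]
      push_cast
      rw [Finset.sum_comm]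
      refine Finset.sum_congr rfl fun c _ => ?_
      rw [sq, Finset.sum_mul_sum, Finset.sum_product]
      refine Finset.sum_congr rfl fun b _ => Finset.sum_congr rfl fun b' _ => ?_
      by_cases h1 : c / b ∈ A <;> by_cases h2 : c / b' ∈ A <;> simp [h1, h2]
    have hcs := sq_sum_le_card_mul_sum_sq (s := Cs) (f := fun c => ((B'.filter fun β => c / β ∈ A).card : ℝ))
    rw [← e, hswap Cs B'] at hcs
    have h1 : (n ^ 2 / 4) ^ 2 ≤ q * ∑ z ∈ B' ×ˢ B', ((Y z.1 z.2).card : ℝ) := by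
      calc _ ≤ (∑ b ∈ B', ((w b).card : ℝ)) ^ 2 := by gcongr
        _ ≤ _ := hcs
        _ ≤ _ := by
          gcongr
          rw [← hq]; exact_mod_cast Finset.card_filter_le _ _
    rw [div_le_iff₀ (by positivity)]
    nlinarith
  have hY3 : n ^ 8 / (2 ^ 12 * q ^ 3) ≤ ∑ z ∈ B' ×ˢ B', ((Y z.1 z.2).card : ℝ) ^ 3 := by
    have h1 := pow_sum_le_card_mul_sum_pow (s := B' ×ˢ B') (f := fun z => ((Y z.1 z.2).card : ℝ))
      (fun _ _ => Nat.cast_nonneg _) 2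
    rw [Finset.card_product] at h1
    push_cast at h1
    have h2 : (n ^ 4 / (16 * q)) ^ 3 ≤ n ^ 4 * ∑ z ∈ B' ×ˢ B', ((Y z.1 z.2).card : ℝ) ^ 3 := by
      calc _ ≤ (∑ z ∈ B' ×ˢ B', ((Y z.1 z.2).card : ℝ)) ^ 3 := by gcongr
        _ ≤ _ := h1
        _ ≤ (n * n) ^ 2 * ∑ z ∈ B' ×ˢ B', ((Y z.1 z.2).card : ℝ) ^ 3 := by gcongr
        _ = _ := by ring
    refine le_of_mul_le_mul_left (le_trans (le_of_eq ?_) h2) (by positivity : 0 < n ^ 4)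
    field_simp
    try norm_num
  refine ⟨B', Finset.filter_subset _ _, ?_, ?_⟩
  · intro b hb
    have hb2 := (Finset.mem_filter.mp hb).2
    have h1 : ∑ x ∈ w b, r x ≤ (Pset A B (fun x => x) b).card := by
      simp only [r]
      norm_cast
      rw [← Finset.card_sigma]
      refine Finset.card_le_card_of_injOn (fun z => (z.1, z.2)) ?_ ?_
      · rintro ⟨x, c⟩ hz
        simp [w] at hz
        simp [Pset]
        tauto
      · rintro ⟨x, c⟩ _ ⟨y, d⟩ _ hh
        simp at hh ⊢
        exact hh
    refine le_trans ?_ h1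
    calc n ^ 3 / (8 * q) = (n / 4) * (n ^ 2 / (2 * q)) := by field_simp; ring
      _ ≤ (w b).card * (n ^ 2 / (2 * q)) := by gcongr
      _ ≤ _ := by
        rw [← nsmul_eq_mul]
        refine Finset.card_nsmul_le_sum _ _ _ fun x hx => ?_
        exact (Finset.mem_filter.mp (Finset.mem_filter.mp hx).1).2
  · by_contra hcon
    push Not at hcon
    let N : F → F × F → F × F → F → F → ℝ := fun b0 s β b b' =>
      (((Rset A b b').filter fun x => mp1 b0 s x ∈ Rset A b b' ∧ mp2 β x ∈ Rset A b b').card : ℝ)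
    have hpair : ∀ z ∈ B' ×ˢ B', n ^ 7 / (2 ^ 11 * q ^ 4) * ((Y z.1 z.2).card : ℝ) ^ 3 - 2 * n ^ 5 ≤
        ∑ b0 ∈ B, ∑ s ∈ A.offDiag, ∑ β ∈ B.offDiag, N b0 s β z.1 z.2 := by
      rintro ⟨b, b'⟩ hz
      have hz := Finset.mem_product.mp hz
      have hb := (Finset.mem_filter.mp hz.1).1
      have h1 := choice_pair A B C hA hB hC hCB n q hn hnA hnB hq hq0 b b' hb (Y b b')
        (by
          intro x hx
          simp only [Y, Finset.mem_filter] at hx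
          simp only [Rset, Finset.mem_filter, Finset.mem_univ, true_and]
          exact hx.2)
        (by
          intro y hy
          exact (Finset.mem_filter.mp (Finset.mem_filter.mp hy).1).2)
      refine le_trans (le_of_eq ?_) (h1.trans (le_of_eq ?_))
      · ring
      · refine Finset.sum_congr rfl fun b0 _ => ?_
        simp only [N, Finset.card_filter]
        push_cast
        simp only [Finset.sum_mul_sum]
        rw [Finset.sum_comm]
        refine Finset.sum_congr rfl fun s _ => ?_
        rw [Finset.sum_comm]
        refine Finset.sum_congr rfl fun β _ => ?_
        refine Finset.sum_congr rfl fun x _ => ?_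
        by_cases h1 : mp1 b0 s x ∈ Rset A b b' <;> by_cases h2 : mp2 β x ∈ Rset A b b' <;>
          simp [h1, h2]
    have hs := Finset.sum_le_sum hpair
    rw [Finset.sum_sub_distrib, ← Finset.mul_sum, Finset.sum_const, nsmul_eq_mul, Finset.card_product] at hs
    push_cast at hs
    have hlow : n ^ 15 / (2 ^ 23 * q ^ 7) - 2 * n ^ 7 ≤
        ∑ z ∈ B' ×ˢ B', ∑ b0 ∈ B, ∑ s ∈ A.offDiag, ∑ β ∈ B.offDiag, N b0 s β z.1 z.2 := by
      refine le_trans ?_ hs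
      have k1 : n ^ 7 / (2 ^ 11 * q ^ 4) * (n ^ 8 / (2 ^ 12 * q ^ 3)) ≤
        n ^ 7 / (2 ^ 11 * q ^ 4) * ∑ z ∈ B' ×ˢ B', ((Y z.1 z.2).card : ℝ) ^ 3 := by gcongr
      have k2 : (B'.card : ℝ) * B'.card * (2 * n ^ 5) ≤ n * n * (2 * n ^ 5) := by gcongr
      have k3 : n ^ 15 / (2 ^ 23 * q ^ 7) = n ^ 7 / (2 ^ 11 * q ^ 4) * (n ^ 8 / (2 ^ 12 * q ^ 3)) := by
        field_simp
        try norm_num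
      rw [k3]
      nlinarith
    have hBne : B.Nonempty := by
      rw [← Finset.card_pos]; rw [← hnB] at hn; exact_mod_cast hn
    have hup : ∑ z ∈ B' ×ˢ B', ∑ b0 ∈ B, ∑ s ∈ A.offDiag, ∑ β ∈ B.offDiag, N b0 s β z.1 z.2
        = ∑ θ ∈ B ×ˢ (A.offDiag ×ˢ B.offDiag), ∑ b ∈ B', ∑ b' ∈ B', N θ.1 θ.2.1 θ.2.2 b b' := by
      have e1 : ∀ z ∈ B' ×ˢ B', ∑ b0 ∈ B, ∑ s ∈ A.offDiag, ∑ β ∈ B.offDiag, N b0 s β z.1 z.2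
          = ∑ θ ∈ B ×ˢ (A.offDiag ×ˢ B.offDiag), N θ.1 θ.2.1 θ.2.2 z.1 z.2 := by
        intro z _
        rw [Finset.sum_product]
        refine Finset.sum_congr rfl fun b0 _ => ?_
        rw [Finset.sum_product]
      rw [Finset.sum_congr rfl e1, Finset.sum_comm]
      refine Finset.sum_congr rfl fun θ _ => ?_
      rw [Finset.sum_product]
    have hle : ∑ θ ∈ B ×ˢ (A.offDiag ×ˢ B.offDiag), ∑ b ∈ B', ∑ b' ∈ B', N θ.1 θ.2.1 θ.2.2 b b'
        ≤ ((B ×ˢ (A.offDiag ×ˢ B.offDiag)).card : ℝ) * (n ^ 10 / (2 ^ 24 * q ^ 7)) := by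
      rw [← nsmul_eq_mul]
      refine Finset.sum_le_card_nsmul _ _ _ ?_
      rintro ⟨b0, s, β⟩ hθ
      simp only [Finset.mem_product] at hθ
      exact (hcon b0 hθ.1 s hθ.2.1 β hθ.2.2).le
    have hcard : ((B ×ˢ (A.offDiag ×ˢ B.offDiag)).card : ℝ) ≤ n ^ 5 - n ^ 4 := by
      rw [Finset.card_product, Finset.card_product, Finset.offDiag_card, Finset.offDiag_card]
      have h1 : ((A.card * A.card - A.card : ℕ) : ℝ) = n ^ 2 - n := by
        rw [Nat.cast_sub (Nat.le_mul_self _)]; push_cast; rw [hnA]; ring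
      have h2 : ((B.card * B.card - B.card : ℕ) : ℝ) = n ^ 2 - n := by
        rw [Nat.cast_sub (Nat.le_mul_self _)]; push_cast; rw [hnB]; ring
      rw [Nat.cast_mul, Nat.cast_mul, h1, h2, hnB]
      have : 1 ≤ n := by rw [← hnB]; exact_mod_cast hBne.card_pos
      have h3 : n ^ 3 ≤ n ^ 4 := pow_le_pow_right₀ this (by norm_num)
      nlinarith
    rw [hup] at hlow
    have h5 := hlow.trans hle
    have h6 : 2 * n ^ 7 ≤ n ^ 15 / (2 ^ 24 * q ^ 7) := by
      rw [le_div_iff₀ (by positivity)]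
      have := mul_le_mul_of_nonneg_left hbig (by positivity : 0 ≤ n ^ 7)
      nlinarith
    have hpos : 0 < n ^ 10 / (2 ^ 24 * q ^ 7) := by positivity
    have h7 := mul_le_mul_of_nonneg_right hcard hpos.le
    have h8 : n ^ 15 / (2 ^ 23 * q ^ 7) = 2 * (n ^ 5 * (n ^ 10 / (2 ^ 24 * q ^ 7))) := by
      field_simp
      try norm_num
    have h9 : n ^ 15 / (2 ^ 24 * q ^ 7) = n ^ 5 * (n ^ 10 / (2 ^ 24 * q ^ 7)) := by
      field_simp
    have h10 : 0 < n ^ 4 * (n ^ 10 / (2 ^ 24 * q ^ 7)) := by positivity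
    nlinarith
end


lemma core_bound {p : ℕ} [Fact p.Prime] (A B C : Finset (ZMod p)) (hA : ∀ a ∈ A, a ≠ 0)
    (hB : ∀ b ∈ B, b ≠ 0)
    (hC : ∀ s ∈ A, ∀ a ∈ A, s * (a + 1) ∈ C) (hCB : ∀ a ∈ A, ∀ b ∈ B, b * a ∈ C)
    (n q : ℝ) (hn : 0 < n) (hnA : (A.card : ℝ) = n) (hnB : (B.card : ℝ) = n)
    (hq : (C.card : ℝ) = q) (hqn : n ≤ q) (hnp : n ^ 2 ≤ p) :
    n ^ 26 < 2 ^ 80 * q ^ 25 := by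
  by_contra hcon
  push Not at hcon
  have hq0 : 0 < q := hn.trans_le hqn
  have h8 : 2 ^ 25 * q ^ 7 ≤ n ^ 8 := by
    have h1 : n ^ 18 ≤ q ^ 18 := by gcongr
    have h2 : 2 ^ 80 * q ^ 7 * n ^ 18 ≤ n ^ 8 * n ^ 18 := by
      calc _ ≤ 2 ^ 80 * q ^ 7 * q ^ 18 := by gcongr
        _ = 2 ^ 80 * q ^ 25 := by ring
        _ ≤ n ^ 26 := hcon
        _ = _ := by ring
    have h3 := le_of_mul_le_mul_right h2 (by positivity)
    have : 0 < q ^ 7 := by positivity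
    linarith
  obtain ⟨B', hB', hP0, b0, hb0, ⟨s, s'⟩, hs, ⟨β, β'⟩, hβ, hQ⟩ :=
    choice A B C hA hB hC hCB n q hn hnA hnB hq hq0 h8
  simp only [Finset.mem_offDiag] at hs hβ
  have sn := hA _ hs.1
  have sn' := hA _ hs.2.1
  have bn := hB _ hβ.1
  have bn' := hB _ hβ.2.1
  set W : ℝ := n ^ 9 / (2 ^ 26 * q ^ 7) with hWdef
  have hW : 0 < W := by positivity
  have hB'n : (B'.card : ℝ) ≤ n := by
    rw [← hnB]; exact_mod_cast Finset.card_le_card hB'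
  obtain ⟨B1, hB1, hne, hsum⟩ := prune B' (fun b b' => (((Rset A b b').filter fun x =>
      mp1 b0 (s, s') x ∈ Rset A b b' ∧ mp2 (β, β') x ∈ Rset A b b').card : ℝ))
    (fun _ _ => Nat.cast_nonneg _)
    (by
      intro b b'
      have : Rset A b b' = Rset A b' b := by
        simp only [Rset, and_comm]
      simp only [this])
    W
    (by
      refine lt_of_lt_of_le ?_ hQ
      have h1 : n ^ 10 / (2 ^ 24 * q ^ 7) = 4 * W * n := by
        rw [hWdef]; field_simp; norm_num
      rw [h1]
      have : W * B'.card ≤ W * n := by gcongr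
      have : 0 < W * n := by positivity
      nlinarith)
  have hPgen : ∀ (h : ZMod p → ZMod p), (∀ b b' x, x ∈ ((Rset A b b').filter fun x =>
      mp1 b0 (s, s') x ∈ Rset A b b' ∧ mp2 (β, β') x ∈ Rset A b b') → h x ∈ Rset A b b') →
      ∀ b ∈ B1, W ≤ (Pset A B1 h b).card := by
    intro h hh b hb
    refine (hsum b hb).trans ?_
    norm_cast
    rw [← Finset.card_sigma]
    refine Finset.card_le_card_of_injOn (fun z => (z.2, z.1)) ?_ ?_
    · rintro ⟨c, x⟩ hz
      rw [Finset.mem_coe, Finset.mem_sigma] at hz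
      have h1 := hh b c x hz.2
      have h2 := (Finset.mem_filter.mp hz.2).1
      have h3 := hz.1
      simp only [Rset, Finset.mem_filter, Finset.mem_univ, true_and] at h1 h2
      simp only [Pset, Finset.coe_filter, Finset.mem_product, Finset.mem_univ, true_and,
        Set.mem_ofPred_eq]
      exact ⟨h3, h2.1, h1.2⟩
    · rintro ⟨c, x⟩ _ ⟨d, y⟩ _ hxy
      simp at hxy ⊢
      tauto
  have hfin := main_arg A B C B1 hA hB hC (hB1.trans hB') hne n q W (n ^ 3 / (8 * q)) hn hnA hnB hq hqn
    hnp hW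
    (by
      rw [hWdef, div_le_div_iff₀ (by positivity) (by positivity)]
      have h1 : n ^ 6 ≤ q ^ 6 := by gcongr
      have h2 : n ^ 3 * q * n ^ 6 ≤ n ^ 3 * q * q ^ 6 := by gcongr
      have h3 : 0 < n ^ 3 * q ^ 7 := by positivity
      nlinarith)
    (s / s') ((s / s' - 1) * b0) (β / β') (div_ne_zero sn sn')
    (by
      refine mul_ne_zero (sub_ne_zero.mpr ?_) (hB _ hb0)
      rw [Ne, div_eq_one_iff_eq sn']
      exact hs.2.2)
    (div_ne_zero bn bn')
    (by
      rw [Ne, div_eq_one_iff_eq bn']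
      exact hβ.2.2)
    (by
      rw [hWdef, div_pow, le_div_iff₀ (by positivity)]
      calc 4 * q ^ 4 * n * (2 ^ 26 * q ^ 7) ^ 3 = n * (2 ^ 80 * q ^ 25) := by ring
        _ ≤ n * n ^ 26 := by gcongr
        _ = _ := by ring)
    (hPgen _ fun b b' x hx => (Finset.mem_filter.mp hx).2.1)
    (hPgen _ fun b b' x hx => (Finset.mem_filter.mp hx).2.2)
    (fun b hb => hP0 b (hB1 hb))
  rw [div_pow, div_le_iff₀ (by positivity)] at hfin
  have h10 : n ^ 2 * n ^ 10 ≤ n ^ 2 * (2 ^ 15 * q ^ 9) := by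
    calc _ = (n ^ 3) ^ 4 := by ring
      _ ≤ _ := hfin
      _ = _ := by ring
  have h11 := le_of_mul_le_mul_left h10 (by positivity)
  have h12 : 2 ^ 80 * q ^ 9 * n ^ 16 ≤ n ^ 10 * n ^ 16 := by
    have h1 : n ^ 16 ≤ q ^ 16 := by gcongr
    calc _ ≤ 2 ^ 80 * q ^ 9 * q ^ 16 := by gcongr
      _ = 2 ^ 80 * q ^ 25 := by ring
      _ ≤ n ^ 26 := hcon
      _ = _ := by ring
  have h13 := le_of_mul_le_mul_right h12 (by positivity)
  have : 0 < q ^ 9 := by positivity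
  linarith

lemma core_bound' {p : ℕ} [Fact p.Prime] (A : Finset (ZMod p)) (h0 : (0 : ZMod p) ∉ A) (h1 : (-1 : ZMod p) ∉ A)
    (hne : A.Nonempty) (hnp : (A.card : ℝ) ^ 2 ≤ p) :
    (A.card : ℝ) ^ 26 < 2 ^ 80 * ((A * (A + {1})).card : ℝ) ^ 25 := by
  have hB : ∀ b ∈ A + {1}, b ≠ 0 := by
    intro b hb
    rw [Finset.mem_add] at hb
    obtain ⟨a, ha, c, hc, rfl⟩ := hb
    rw [Finset.mem_singleton] at hc
    subst hc
    intro h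
    exact h1 (eq_neg_of_add_eq_zero_left h ▸ ha)
  have hA : ∀ a ∈ A, a ≠ 0 := fun a ha h => h0 (h ▸ ha)
  refine core_bound A (A + {1}) (A * (A + {1})) hA hB ?_ ?_ _ _ ?_ rfl ?_ rfl ?_ hnp
  · intro s hs a ha
    exact Finset.mul_mem_mul hs (Finset.add_mem_add ha (Finset.mem_singleton_self _))
  · intro a ha b hb
    have := Finset.mul_mem_mul ha hb
    rwa [mul_comm a b] at this
  · exact_mod_cast hne.card_pos
  · have : A + {1} = A.image (fun x => x + 1) := by
      ext x; simp only [Finset.mem_add, Finset.mem_image, Finset.mem_singleton, exists_eq_left]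
    rw [this, Finset.card_image_of_injective _ (add_left_injective _)]
  · norm_cast
    obtain ⟨a, ha⟩ := hne
    have hb : a + 1 ∈ A + {1} := Finset.add_mem_add ha (Finset.mem_singleton_self _)
    refine Finset.card_le_card_of_injOn (fun x => x * (a + 1)) ?_ ?_
    · intro x hx
      exact Finset.mul_mem_mul hx hb
    · intro x _ y _ h
      exact mul_right_cancel₀ (hB _ hb) h

/-- For `A ⊆ 𝔽_p` with `|A| ≤ √p`, `|A·(A+1)| ≫ |A|^(1+1/26)`. -/
theorem shifted_product_bound :
    ∃ c : ℝ, 0 < c ∧ ∀ (p : ℕ), p.Prime → ∀ (A : Finset (ZMod p)),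
      (A.card : ℝ) ≤ Real.sqrt p →
      c * (A.card : ℝ) ^ ((1 : ℝ) + 1 / 26) ≤ ((A * (A + {1})).card : ℝ) := by
  refine ⟨1 / 64, by norm_num, ?_⟩
  intro p hp A hAp
  have : Fact p.Prime := ⟨hp⟩
  rcases A.eq_empty_or_nonempty with rfl | hne
  · simp only [Finset.card_empty, Nat.cast_zero]
    rw [Real.zero_rpow (by norm_num)]
    simp
  have hN1 : (1 : ℝ) ≤ A.card := by exact_mod_cast hne.card_pos
  have hq1 : (1 : ℝ) ≤ ((A * (A + {1})).card : ℝ) := by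
    have : (A * (A + {1})).Nonempty := hne.mul (hne.add (Finset.singleton_nonempty _))
    exact_mod_cast this.card_pos
  set A0 : Finset (ZMod p) := (A.erase 0).erase (-1) with hA0
  have hsub : A0 ⊆ A := (Finset.erase_subset _ _).trans (Finset.erase_subset _ _)
  have hcard : (A.card : ℝ) ≤ A0.card + 2 := by
    have h1 := Finset.pred_card_le_card_erase (s := A) (a := 0)
    have h2 := Finset.pred_card_le_card_erase (s := A.erase 0) (a := -1)
    rw [← hA0] at h2
    have : A.card ≤ A0.card + 2 := by omega
    exact_mod_cast this
  rcases A0.eq_empty_or_nonempty with he | hne0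
  · rw [he] at hcard
    simp only [Finset.card_empty, Nat.cast_zero, zero_add] at hcard
    have h1 : (A.card : ℝ) ^ ((1 : ℝ) + 1 / 26) ≤ (A.card : ℝ) ^ (2 : ℝ) :=
      Real.rpow_le_rpow_of_exponent_le hN1 (by norm_num)
    rw [Real.rpow_two] at h1
    nlinarith
  · have hn1 : (1 : ℝ) ≤ A0.card := by exact_mod_cast hne0.card_pos
    have hle : (A0.card : ℝ) ≤ A.card := by exact_mod_cast Finset.card_le_card hsub
    have hc := core_bound' A0 (by simp [hA0]) (by simp [hA0]) hne0 (by
      have h1 : (A0.card : ℝ) ≤ Real.sqrt p := hle.trans hAp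
      calc (A0.card : ℝ) ^ 2 ≤ Real.sqrt p ^ 2 := by gcongr
        _ = (p : ℝ) := Real.sq_sqrt (Nat.cast_nonneg _))
    have hqq : ((A0 * (A0 + {1})).card : ℝ) ≤ ((A * (A + {1})).card : ℝ) := by
      exact_mod_cast Finset.card_le_card (Finset.mul_subset_mul hsub (Finset.add_subset_add_right hsub))
    by_contra hcon
    push Not at hcon
    have h3 : (A.card : ℝ) ≤ 3 * A0.card := by linarith
    have h4 : ((A.card : ℝ) ^ ((1 : ℝ) + 1 / 26)) ^ 25 ≤ (A.card : ℝ) ^ 26 := by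
      rw [← Real.rpow_natCast, ← Real.rpow_mul (by positivity), ← Real.rpow_natCast]
      exact Real.rpow_le_rpow_of_exponent_le hN1 (by norm_num)
    have h5 : (A0.card : ℝ) ^ 26 < 2 ^ 80 * ((1 / 64) ^ 25 * (3 * A0.card) ^ 26) := by
      calc _ < _ := hc
        _ ≤ 2 ^ 80 * (1 / 64 * (A.card : ℝ) ^ ((1 : ℝ) + 1 / 26)) ^ 25 := by
          gcongr
          exact hqq.trans hcon.le
        _ = 2 ^ 80 * ((1 / 64) ^ 25 * ((A.card : ℝ) ^ ((1 : ℝ) + 1 / 26)) ^ 25) := by ring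
        _ ≤ 2 ^ 80 * ((1 / 64) ^ 25 * (A.card : ℝ) ^ 26) := by gcongr
        _ ≤ _ := by gcongr
    rw [mul_pow] at h5
    have h6 : 0 < (A0.card : ℝ) ^ 26 := by positivity
    norm_num at h5
    linarith
end
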